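/- arXiv:0806.2582 — 4 statements merged into one kernel-verified Lean document; each statement's English description precedes it below -/
import Mathlib

section
/- Define the concave integral functional I_u : L^û(P) → [-∞, ∞) by I_u(f) := E[u(f)] (well-defined since L^û(P) ⊆ L¹(P) and u(x) ≤ u(0) + D⁻u(0)·x), and let 𝒟 := {f ∈ L^û(P) : E[u(f)] > -∞} be its proper domain. Then the open unit ball B := {f ∈ L^û(P) : N_û(f) < 1} is contained in 𝒟, and on B one has the bounds u(0) - 1 ≤ I_u(f) ≤ u(E[f]) < ∞; consequently 𝒟 has nonempty interior with respect to the Luxemburg norm N_û, and I_u is finite-valued and N_û-continuous at every point of the interior of 𝒟. -/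
open MeasureTheory Filter Set Topology
open scoped ENNReal

noncomputable section

/-- The positive part of an extended real number, as an element of `ℝ≥0∞`. -/
def EReal.toENN (x : EReal) : ℝ≥0∞ := if x = ⊤ then ⊤ else ENNReal.ofReal x.toReal

namespace OrliczAux

/-- Concavity of the real-valued version of `u` on the set where `u` is finite. -/
lemma concave_real (a : EReal) (u : ℝ → EReal)
    (hu_ne_top : ∀ x : ℝ, u x ≠ ⊤)
    (hu_bot : ∀ x : ℝ, (x : EReal) < a → u x = ⊥)
    (hu_mono : Monotone u)
    (hu_conc : ∀ x y t : ℝ, a < (x : EReal) → a < (y : EReal) → 0 ≤ t → t ≤ 1 →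
      ((t * (u x).toReal + (1 - t) * (u y).toReal : ℝ) : EReal) ≤ u (t * x + (1 - t) * y)) :
    ConcaveOn ℝ {x | u x ≠ ⊥} (fun x => (u x).toReal) := by
  have hmono : ∀ x y, u x ≠ ⊥ → x ≤ y → (u x).toReal ≤ (u y).toReal := fun x y hx hxy =>
    EReal.toReal_le_toReal (hu_mono hxy) hx (hu_ne_top y)
  have hup : ∀ x y, u x ≠ ⊥ → x ≤ y → u y ≠ ⊥ := fun x y hx hxy h =>
    hx (le_bot_iff.1 (h ▸ hu_mono hxy))
  have hage : ∀ x, u x ≠ ⊥ → a ≤ (x : EReal) := fun x hx => by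
    by_contra h
    exact hx (hu_bot x (not_le.1 h))
  have hconc' : ∀ x y t : ℝ, a < (x : EReal) → a < (y : EReal) → 0 ≤ t → t ≤ 1 →
      t * (u x).toReal + (1 - t) * (u y).toReal ≤ (u (t * x + (1 - t) * y)).toReal := by
    intro x y t hx hy h0 h1
    have := EReal.toReal_le_toReal (hu_conc x y t hx hy h0 h1) (EReal.coe_ne_bot _) (hu_ne_top _)
    simpa only [EReal.toReal_coe] using this
  refine LinearOrder.concaveOn_of_lt ?_ ?_
  · apply Set.OrdConnected.convex
    exact ⟨fun x hx y _ z hz => hup x z hx hz.1⟩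
  · intro x hx y hy hxy p q hp hq hpq
    simp only [smul_eq_mul]
    have hq' : q = 1 - p := by linarith
    subst hq'
    set z := p * x + (1 - p) * y with hz
    have hxz : x < z := by nlinarith
    have key : ∀ s ∈ Ioo p 1, s * (u x).toReal + (1 - s) * (u y).toReal ≤ (u z).toReal := by
      intro s hs
      have hs0 : 0 < s := hp.trans hs.1
      set w := y - (y - z) / s with hw
      have hyz : y - z = p * (y - x) := by rw [hz]; ring
      have hxw : x < w := by
        have : (y - z) / s < y - x := by
          rw [div_lt_iff₀ hs0, hyz]
          nlinarith [hs.1]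
        linarith
      have haw : a < (w : EReal) := (hage x hx).trans_lt (by exact_mod_cast hxw)
      have hay : a < (y : EReal) := (hage x hx).trans_lt (by exact_mod_cast hxy)
      have h1 := hconc' w y s haw hay hs0.le hs.2.le
      have h2 : s * w + (1 - s) * y = z := by
        rw [hw]; field_simp; ring
      rw [h2] at h1
      have h3 := hmono x w hx hxw.le
      nlinarith
    have hcont : Tendsto (fun s : ℝ => s * (u x).toReal + (1 - s) * (u y).toReal) (𝓝[>] p)
        (𝓝 (p * (u x).toReal + (1 - p) * (u y).toReal)) := by
      apply Tendsto.mono_left _ nhdsWithin_le_nhds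
      apply Continuous.tendsto'
      · fun_prop
      · rfl
    refine le_of_tendsto hcont ?_
    filter_upwards [Ioo_mem_nhdsGT (show p < 1 by linarith)] with s hs using key s hs

/-- Existence of a supergradient at interior points. -/
lemma supergrad {S : Set ℝ} {v : ℝ → ℝ} (h : ConcaveOn ℝ S v) {m : ℝ} (hm : m ∈ interior S) :
    ∃ k : ℝ, ∀ x ∈ S, v x ≤ v m + k * (x - m) := by
  have hf : ConvexOn ℝ S (-v) := h.neg
  refine ⟨-derivWithin (-v) (Ioi m) m, fun x hx => ?_⟩
  rcases lt_trichotomy m x with hxy | h_eq | hyx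
  · have := hf.rightDeriv_le_slope_of_mem_interior hm hx hxy
    rw [slope_def_field, le_div_iff₀ (by linarith)] at this
    simp only [Pi.neg_apply] at this
    linarith
  · simp [h_eq]
  · have := (hf.slope_le_leftDeriv_of_mem_interior hx hm hyx).trans
      (hf.leftDeriv_le_rightDeriv_of_mem_interior hm)
    rw [slope_def_field, div_le_iff₀ (by linarith)] at this
    simp only [Pi.neg_apply] at this
    linarith

/-- Continuity of a concave functional, abstract version of the estimate. -/
lemma integral_concave {Ω : Type*} [MeasurableSpace Ω] (P : Measure Ω) {S : Set ℝ} {v : ℝ → ℝ}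
    (h : ConcaveOn ℝ S v) {p q w : Ω → ℝ} {s t : ℝ} (hs : 0 ≤ s) (ht : 0 ≤ t) (hst : s + t = 1)
    (hp : Integrable (fun ω => v (p ω)) P) (hq : Integrable (fun ω => v (q ω)) P)
    (hw : Integrable (fun ω => v (w ω)) P)
    (hqS : ∀ᵐ ω ∂P, q ω ∈ S) (hwS : ∀ᵐ ω ∂P, w ω ∈ S) (heq : ∀ ω, p ω = s * q ω + t * w ω) :
    s * ∫ ω, v (q ω) ∂P + t * ∫ ω, v (w ω) ∂P ≤ ∫ ω, v (p ω) ∂P := by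
  rw [← integral_const_mul, ← integral_const_mul, ← integral_add (hq.const_mul s) (hw.const_mul t)]
  refine integral_mono_ae ((hq.const_mul s).add (hw.const_mul t)) hp ?_
  filter_upwards [hqS, hwS] with ω h1 h2
  have := h.2 h1 h2 hs ht hst
  simpa [heq] using this

section uhat

variable (a : EReal) (u : ℝ → EReal) (uhat : ℝ → ℝ≥0∞)

lemma uhat_fin (hu_ne_top : ∀ x : ℝ, u x ≠ ⊤) (h0 : u 0 ≠ ⊥)
    (huhat : ∀ x : ℝ, uhat x = (u 0 - u (-|x|)).toENN) (x : ℝ) (hx : u (-|x|) ≠ ⊥) :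
    uhat x = ENNReal.ofReal ((u 0).toReal - (u (-|x|)).toReal) := by
  rw [huhat, EReal.toENN, ← EReal.toReal_sub (hu_ne_top _) h0 (hu_ne_top _) hx, if_neg]
  lift u 0 to ℝ using ⟨hu_ne_top 0, h0⟩ with r
  lift u (-|x|) to ℝ using ⟨hu_ne_top _, hx⟩ with s
  rw [← EReal.coe_sub]
  exact EReal.coe_ne_top _

lemma uhat_bot (hu_ne_top : ∀ x : ℝ, u x ≠ ⊤) (h0 : u 0 ≠ ⊥)
    (huhat : ∀ x : ℝ, uhat x = (u 0 - u (-|x|)).toENN) (x : ℝ) (hx : u (-|x|) = ⊥) :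
    uhat x = ⊤ := by
  rw [huhat, hx]
  lift u 0 to ℝ using ⟨hu_ne_top 0, h0⟩ with r
  simp [EReal.toENN]

lemma uhat_mono (hu_ne_top : ∀ x : ℝ, u x ≠ ⊤) (h0 : u 0 ≠ ⊥) (hu_mono : Monotone u)
    (huhat : ∀ x : ℝ, uhat x = (u 0 - u (-|x|)).toENN) (x y : ℝ) (hxy : |x| ≤ |y|) :
    uhat x ≤ uhat y := by
  have hm : u (-|y|) ≤ u (-|x|) := hu_mono (neg_le_neg hxy)
  by_cases hy : u (-|y|) = ⊥
  · rw [uhat_bot u uhat hu_ne_top h0 huhat y hy]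
    exact le_top
  · have hx : u (-|x|) ≠ ⊥ := fun h => hy (le_bot_iff.1 (h ▸ hm))
    rw [uhat_fin u uhat hu_ne_top h0 huhat y hy, uhat_fin u uhat hu_ne_top h0 huhat x hx]
    apply ENNReal.ofReal_le_ofReal
    have := EReal.toReal_le_toReal hm hy (hu_ne_top _)
    linarith

lemma uhat_zero (hu_ne_top : ∀ x : ℝ, u x ≠ ⊤) (h0 : u 0 ≠ ⊥)
    (huhat : ∀ x : ℝ, uhat x = (u 0 - u (-|x|)).toENN) : uhat 0 = 0 := by
  rw [uhat_fin u uhat hu_ne_top h0 huhat 0 (by simpa using h0)]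
  simp

lemma uhat_meas (hu_ne_top : ∀ x : ℝ, u x ≠ ⊤) (h0 : u 0 ≠ ⊥) (hu_mono : Monotone u)
    (huhat : ∀ x : ℝ, uhat x = (u 0 - u (-|x|)).toENN) : Measurable uhat := by
  have h1 : Monotone (fun y => uhat (max y 0)) := by
    intro x y hxy
    apply uhat_mono u uhat hu_ne_top h0 hu_mono huhat
    rw [abs_of_nonneg (le_max_right _ _), abs_of_nonneg (le_max_right _ _)]
    exact max_le_max hxy le_rfl
  have h2 : uhat = fun x => (fun y => uhat (max y 0)) |x| := by
    funext x
    apply le_antisymm <;> apply uhat_mono u uhat hu_ne_top h0 hu_mono huhat <;> simp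
  rw [h2]
  exact h1.measurable.comp measurable_abs

lemma uhat_scale (hu_ne_top : ∀ x : ℝ, u x ≠ ⊤) (h0 : u 0 ≠ ⊥)
    (huhat : ∀ x : ℝ, uhat x = (u 0 - u (-|x|)).toENN)
    (hc : ConcaveOn ℝ {x | u x ≠ ⊥} (fun x => (u x).toReal)) (x t : ℝ) (ht : 0 < t)
    (ht1 : t ≤ 1) : uhat (t * x) ≤ ENNReal.ofReal t * uhat x := by
  by_cases hx : u (-|x|) = ⊥
  · rw [uhat_bot u uhat hu_ne_top h0 huhat x hx, ENNReal.mul_top]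
    · exact le_top
    · simpa using ht
  · have h1 := hc.1 hx h0 ht.le (sub_nonneg.2 ht1) (by ring)
    have h2 := hc.2 hx h0 ht.le (sub_nonneg.2 ht1) (by ring)
    have e : t * -|x| + (1 - t) * 0 = -|t * x| := by rw [abs_mul, abs_of_pos ht]; ring
    simp only [smul_eq_mul, e] at h1 h2
    rw [uhat_fin u uhat hu_ne_top h0 huhat x hx, uhat_fin u uhat hu_ne_top h0 huhat _ h1,
      ← ENNReal.ofReal_mul ht.le]
    apply ENNReal.ofReal_le_ofReal
    linarith

/-- Linear growth of the Young function. -/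
lemma uhat_growth (hu_ne_top : ∀ x : ℝ, u x ≠ ⊤) (h0 : u 0 ≠ ⊥)
    (huhat : ∀ x : ℝ, uhat x = (u 0 - u (-|x|)).toENN) (hu_mono : Monotone u)
    (hu_lim : Tendsto u atBot (𝓝 ⊥))
    (hc : ConcaveOn ℝ {x | u x ≠ ⊥} (fun x => (u x).toReal)) :
    ∃ K : ℝ, 0 < K ∧ ∀ x, ENNReal.ofReal |x| ≤ ENNReal.ofReal K * (1 + uhat x) := by
  have h1 : ∀ᶠ x in atBot, u x < (((u 0).toReal - 1 : ℝ) : EReal) :=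
    hu_lim.eventually (gt_mem_nhds (EReal.bot_lt_coe _))
  obtain ⟨x0, hx0, hx0'⟩ := (h1.and (eventually_lt_atBot (0 : ℝ))).exists
  set K := -x0 with hK
  have hKpos : 0 < K := by linarith
  have hK1 : 1 ≤ uhat K := by
    have e : -|K| = x0 := by rw [abs_of_pos hKpos, hK, neg_neg]
    by_cases hb : u (-|K|) = ⊥
    · rw [uhat_bot u uhat hu_ne_top h0 huhat K hb]
      exact le_top
    · rw [uhat_fin u uhat hu_ne_top h0 huhat K hb, ENNReal.one_le_ofReal]
      rw [e] at hb ⊢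
      have := EReal.toReal_le_toReal hx0.le hb (EReal.coe_ne_top _)
      rw [EReal.toReal_coe] at this
      linarith
  refine ⟨K, hKpos, fun x => ?_⟩
  rcases le_or_gt |x| K with hx | hx
  · calc ENNReal.ofReal |x| ≤ ENNReal.ofReal K * 1 := by
          rw [mul_one]; exact ENNReal.ofReal_le_ofReal hx
      _ ≤ _ := by gcongr; exact le_self_add
  · have hxpos : 0 < |x| := hKpos.trans hx
    have h2 := uhat_scale u uhat hu_ne_top h0 huhat hc |x| (K / |x|) (by positivity)
      ((div_le_one hxpos).2 hx.le)
    rw [div_mul_cancel₀ _ hxpos.ne'] at h2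
    have h3 : uhat |x| ≤ uhat x := uhat_mono u uhat hu_ne_top h0 hu_mono huhat _ _ (by simp)
    have h4 : 1 ≤ ENNReal.ofReal (K / |x|) * uhat x := hK1.trans (h2.trans (by gcongr))
    calc ENNReal.ofReal |x| ≤ ENNReal.ofReal |x| * (ENNReal.ofReal (K / |x|) * uhat x) :=
          le_mul_of_one_le_right zero_le h4
      _ = ENNReal.ofReal K * uhat x := by
          rw [← mul_assoc, ← ENNReal.ofReal_mul hxpos.le, mul_div_cancel₀ _ hxpos.ne']
      _ ≤ _ := by gcongr; exact le_add_self

end uhat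

end OrliczAux

/-- Proposition 16.  The open unit ball `B` of `L^û(P)` is contained in the
proper domain `𝒟 = {f ∈ L^û : E[u(f)] > -∞}` of the concave integral functional
`I_u(f) = E[u(f)]`, and on `B` one has `u(0) - 1 ≤ I_u(f) ≤ u(E[f]) < ∞`.  Consequently `𝒟`
has nonempty interior for the Luxemburg norm `N_û`, and `I_u` is finite-valued and
`N_û`-continuous at every interior point of `𝒟`. -/
theorem statement6
    {Ω : Type*} [MeasurableSpace Ω] (P : Measure Ω) [IsProbabilityMeasure P]
    (a : EReal) (ha : a < 0)
    (u : ℝ → EReal)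
    (hu_ne_top : ∀ x : ℝ, u x ≠ ⊤)
    (hu_bot : ∀ x : ℝ, (x : EReal) < a → u x = ⊥)
    (hu_fin : ∀ x : ℝ, a < (x : EReal) → u x ≠ ⊥)
    (hu_mono : Monotone u)
    (hu_conc : ∀ x y t : ℝ, a < (x : EReal) → a < (y : EReal) → 0 ≤ t → t ≤ 1 →
      ((t * (u x).toReal + (1 - t) * (u y).toReal : ℝ) : EReal) ≤ u (t * x + (1 - t) * y))
    (hu_lim : Tendsto u atBot (𝓝 ⊥))
    -- the Young function `û(x) = -u(-|x|) + u(0)`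
    (uhat : ℝ → ℝ≥0∞)
    (huhat : ∀ x : ℝ, uhat x = (u 0 - u (-|x|)).toENN)
    -- the Luxemburg norm
    (Nu : (Ω → ℝ) → ℝ)
    (hNu : ∀ f : Ω → ℝ, Nu f = sInf {c : ℝ | 0 < c ∧ ∫⁻ ω, uhat (f ω / c) ∂P ≤ 1})
    -- the Orlicz space `L^û(P)`
    (LU : Set (Ω → ℝ))
    (hLU : ∀ f : Ω → ℝ, f ∈ LU ↔
      Measurable f ∧ ∃ α : ℝ, 0 < α ∧ ∫⁻ ω, uhat (α * f ω) ∂P < ⊤)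
    -- the proper domain `𝒟 = {f ∈ L^û : E[u(f)] > -∞}` of `I_u`
    (D : Set (Ω → ℝ))
    (hD : ∀ f : Ω → ℝ, f ∈ D ↔ f ∈ LU ∧
      ∃ g : Ω → ℝ, Integrable g P ∧ ∀ᵐ ω ∂P, u (f ω) = (g ω : EReal)) :
    -- the open unit ball is contained in `𝒟`, with the bounds `u(0) - 1 ≤ I_u ≤ u(E[·])`
    (∀ f ∈ LU, Nu f < 1 →
      f ∈ D ∧ Integrable f P ∧ Integrable (fun ω => (u (f ω)).toReal) P ∧
      (u 0).toReal - 1 ≤ ∫ ω, (u (f ω)).toReal ∂P ∧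
      ((∫ ω, (u (f ω)).toReal ∂P : ℝ) : EReal) ≤ u (∫ ω, f ω ∂P)) ∧
    -- `𝒟` has nonempty `N_û`-interior
    (∃ f ∈ D, ∃ r : ℝ, 0 < r ∧ ∀ g ∈ LU, Nu (g - f) < r → g ∈ D) ∧
    -- `I_u` is finite-valued and `N_û`-continuous at every interior point of `𝒟`
    (∀ f ∈ LU, (∃ r : ℝ, 0 < r ∧ ∀ g ∈ LU, Nu (g - f) < r → g ∈ D) →
      f ∈ D ∧ Integrable (fun ω => (u (f ω)).toReal) P ∧
      ∀ ε : ℝ, 0 < ε → ∃ δ : ℝ, 0 < δ ∧ ∀ g ∈ LU, Nu (g - f) < δ →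
        |(∫ ω, (u (g ω)).toReal ∂P) - ∫ ω, (u (f ω)).toReal ∂P| < ε) := by
  have h0 : u 0 ≠ ⊥ := hu_fin 0 (by simpa using ha)
  have hc := OrliczAux.concave_real a u hu_ne_top hu_bot hu_mono hu_conc
  have hInterior : ∀ m : ℝ, a < (m : EReal) → m ∈ interior {x | u x ≠ ⊥} := by
    intro m hm
    have ho : IsOpen {x : ℝ | a < (x : EReal)} := isOpen_lt continuous_const continuous_coe_real_ereal
    exact interior_maximal (fun x hx => hu_fin x hx) ho hm
  have hage : ∀ x, u x ≠ ⊥ → a ≤ (x : EReal) := fun x hx => by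
    by_contra h
    exact hx (hu_bot x (not_le.1 h))
  have hup : ∀ x y, u x ≠ ⊥ → x ≤ y → u y ≠ ⊥ := fun x y hx hxy h =>
    hx (le_bot_iff.1 (h ▸ hu_mono hxy))
  have hmo := OrliczAux.uhat_mono u uhat hu_ne_top h0 hu_mono huhat
  have hme := OrliczAux.uhat_meas u uhat hu_ne_top h0 hu_mono huhat
  have hz := OrliczAux.uhat_zero u uhat hu_ne_top h0 huhat
  have hscale := OrliczAux.uhat_scale u uhat hu_ne_top h0 huhat hc
  obtain ⟨K, hK, hgrow⟩ := OrliczAux.uhat_growth u uhat hu_ne_top h0 huhat hu_mono hu_lim hc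
  have hvmeas : Measurable (fun x => (u x).toReal) :=
    measurable_ereal_toReal.comp hu_mono.measurable
  -- integrability of elements with finite modular
  have hL1 : ∀ f : Ω → ℝ, Measurable f → ∫⁻ ω, uhat (f ω) ∂P < ⊤ → Integrable f P := by
    intro f hf hlt
    refine ⟨hf.aestronglyMeasurable, ?_⟩
    rw [hasFiniteIntegral_iff_norm]
    calc ∫⁻ ω, ENNReal.ofReal ‖f ω‖ ∂P
        ≤ ∫⁻ ω, ENNReal.ofReal K * (1 + uhat (f ω)) ∂P := lintegral_mono fun ω => hgrow (f ω)
      _ = ENNReal.ofReal K * (1 + ∫⁻ ω, uhat (f ω) ∂P) := by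
          rw [lintegral_const_mul _ (by fun_prop), lintegral_add_left (by fun_prop)]
          simp
      _ < ⊤ := ENNReal.mul_lt_top ENNReal.ofReal_lt_top
          (ENNReal.add_lt_top.2 ⟨ENNReal.one_lt_top, hlt⟩)
  -- the main estimate on the unit ball
  have hball : ∀ (f : Ω → ℝ) (c : ℝ), Measurable f → 0 < c → c < 1 →
      ∫⁻ ω, uhat (f ω / c) ∂P ≤ 1 →
      (∀ᵐ ω ∂P, u (f ω) ≠ ⊥) ∧ Integrable f P ∧ Integrable (fun ω => (u (f ω)).toReal) P ∧
      (u 0).toReal - 1 ≤ ∫ ω, (u (f ω)).toReal ∂P ∧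
      ((∫ ω, (u (f ω)).toReal ∂P : ℝ) : EReal) ≤ u (∫ ω, f ω ∂P) := by
    intro f c hf hc0 hc1 hle
    have hle' : ∫⁻ ω, uhat (f ω) ∂P ≤ 1 := by
      refine le_trans (lintegral_mono fun ω => hmo _ _ ?_) hle
      rw [abs_div, abs_of_pos hc0, le_div_iff₀ hc0]
      exact mul_le_of_le_one_right (abs_nonneg _) hc1.le
    have hfi : Integrable f P := hL1 f hf (hle'.trans_lt ENNReal.one_lt_top)
    have hSc : ∀ᵐ ω ∂P, u (-|f ω / c|) ≠ ⊥ := by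
      filter_upwards [ae_lt_top (hme.comp (hf.div_const c))
        (hle.trans_lt ENNReal.one_lt_top).ne] with ω hω hb
      exact hω.ne (OrliczAux.uhat_bot u uhat hu_ne_top h0 huhat _ hb)
    have hSn : ∀ᵐ ω ∂P, u (-|f ω|) ≠ ⊥ := by
      filter_upwards [ae_lt_top (hme.comp hf)
        (hle'.trans_lt ENNReal.one_lt_top).ne] with ω hω hb
      exact hω.ne (OrliczAux.uhat_bot u uhat hu_ne_top h0 huhat _ hb)
    have hS : ∀ᵐ ω ∂P, u (f ω) ≠ ⊥ := by
      filter_upwards [hSn] with ω hω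
      exact hup _ _ hω (neg_abs_le _)
    -- integrable lower bound
    have hgi : Integrable (fun ω => (uhat (f ω)).toReal) P :=
      integrable_toReal_of_lintegral_ne_top (hme.comp hf).aemeasurable
        (hle'.trans_lt ENNReal.one_lt_top).ne
    have hlow : ∀ᵐ ω ∂P, (u 0).toReal - (uhat (f ω)).toReal ≤ (u (f ω)).toReal := by
      filter_upwards [hSn] with ω hω
      have h1 : (u (-|f ω|)).toReal ≤ (u 0).toReal :=
        EReal.toReal_le_toReal (hu_mono (by simp)) hω (hu_ne_top _)
      have h2 : (u (-|f ω|)).toReal ≤ (u (f ω)).toReal :=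
        EReal.toReal_le_toReal (hu_mono (neg_abs_le _)) hω (hu_ne_top _)
      rw [OrliczAux.uhat_fin u uhat hu_ne_top h0 huhat _ hω, ENNReal.toReal_ofReal (by linarith)]
      linarith
    obtain ⟨k, hk⟩ := OrliczAux.supergrad hc (hInterior 0 (by simpa using ha))
    have hupb : ∀ᵐ ω ∂P, (u (f ω)).toReal ≤ (u 0).toReal + k * f ω := by
      filter_upwards [hS] with ω hω
      simpa using hk (f ω) hω
    have hvi : Integrable (fun ω => (u (f ω)).toReal) P :=
      integrable_of_le_of_le (hvmeas.comp hf).aestronglyMeasurable hlow hupb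
        ((integrable_const _).sub hgi) ((integrable_const _).add (hfi.const_mul k))
    refine ⟨hS, hfi, hvi, ?_, ?_⟩
    · have hti : ∫ ω, (uhat (f ω)).toReal ∂P = (∫⁻ ω, uhat (f ω) ∂P).toReal :=
        integral_toReal (hme.comp hf).aemeasurable
          (ae_lt_top (hme.comp hf) (hle'.trans_lt ENNReal.one_lt_top).ne)
      have h1 : ∫ ω, ((u 0).toReal - (uhat (f ω)).toReal) ∂P ≤ ∫ ω, (u (f ω)).toReal ∂P :=
        integral_mono_ae ((integrable_const _).sub hgi) hvi hlow
      rw [integral_sub (integrable_const _) hgi, hti] at h1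
      have h2 : (∫⁻ ω, uhat (f ω) ∂P).toReal ≤ 1 := by
        simpa using ENNReal.toReal_mono ENNReal.one_ne_top hle'
      simp only [integral_const, probReal_univ, smul_eq_mul, one_mul] at h1
      linarith
    · have hm : a < ((∫ ω, f ω ∂P : ℝ) : EReal) := by
        induction a with
        | bot => exact EReal.bot_lt_coe _
        | top => exact absurd ha (by simp)
        | coe b =>
          have hb : b < 0 := by exact_mod_cast ha
          have h1 : ∀ᵐ ω ∂P, c * b ≤ f ω := by
            filter_upwards [hSc] with ω hω
            have h2 : b ≤ -|f ω / c| := by exact_mod_cast hage _ hω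
            have h3 : b ≤ f ω / c := h2.trans (neg_abs_le _)
            rw [le_div_iff₀ hc0] at h3
            linarith
          have h2 : ∫ _ω, c * b ∂P ≤ ∫ ω, f ω ∂P := integral_mono_ae (integrable_const _) hfi h1
          simp only [integral_const, probReal_univ, smul_eq_mul, one_mul] at h2
          have h3 : b < ∫ ω, f ω ∂P := by nlinarith
          exact_mod_cast h3
      set m := ∫ ω, f ω ∂P with hmdef
      obtain ⟨k', hk'⟩ := OrliczAux.supergrad hc (hInterior m hm)
      have h1 : ∫ ω, (u (f ω)).toReal ∂P ≤ ∫ ω, ((u m).toReal + k' * (f ω - m)) ∂P := by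
        refine integral_mono_ae hvi
          ((integrable_const _).add ((hfi.sub (integrable_const _)).const_mul k')) ?_
        filter_upwards [hS] with ω hω
        exact hk' (f ω) hω
      have hki : Integrable (fun ω => k' * (f ω - m)) P :=
        (hfi.sub (integrable_const _)).const_mul k'
      rw [integral_add (integrable_const _) hki, integral_const_mul, integral_sub hfi (integrable_const _)] at h1
      simp only [integral_const, probReal_univ, smul_eq_mul, one_mul, ← hmdef, sub_self,
        mul_zero, add_zero] at h1
      rw [← EReal.coe_toReal (hu_ne_top m) (hu_fin m hm)]
      exact_mod_cast h1
  -- the Orlicz space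
  have hLUc : ∀ f ∈ LU, ∃ c : ℝ, 0 < c ∧ ∫⁻ ω, uhat (f ω / c) ∂P ≤ 1 := by
    intro f hf
    obtain ⟨hfm, α, hα, hlt⟩ := (hLU f).1 hf
    set A := ∫⁻ ω, uhat (α * f ω) ∂P with hA
    set t : ℝ := 1 / (A.toReal + 1) with ht
    have hA0 : 0 ≤ A.toReal := ENNReal.toReal_nonneg
    have ht0 : 0 < t := by positivity
    have ht1 : t ≤ 1 := by
      rw [ht, div_le_one (by positivity)]
      linarith
    refine ⟨1 / (t * α), by positivity, ?_⟩
    calc ∫⁻ ω, uhat (f ω / (1 / (t * α))) ∂P = ∫⁻ ω, uhat (t * (α * f ω)) ∂P := by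
          congr with ω
          congr 1
          field_simp
      _ ≤ ∫⁻ ω, ENNReal.ofReal t * uhat (α * f ω) ∂P :=
          lintegral_mono fun ω => hscale _ t ht0 ht1
      _ = ENNReal.ofReal t * A := by
          rw [lintegral_const_mul _ (by fun_prop)]
      _ = ENNReal.ofReal (t * A.toReal) := by
          rw [ENNReal.ofReal_mul ht0.le, ENNReal.ofReal_toReal hlt.ne]
      _ ≤ 1 := by
          rw [ENNReal.ofReal_le_one, ht, one_div, inv_mul_le_iff₀ (by positivity)]
          linarith
  have hNlt : ∀ f ∈ LU, ∀ ρ : ℝ, Nu f < ρ →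
      ∃ c : ℝ, 0 < c ∧ c < ρ ∧ ∫⁻ ω, uhat (f ω / c) ∂P ≤ 1 := by
    intro f hf ρ hρ
    rw [hNu] at hρ
    obtain ⟨c, ⟨hc0, hc1⟩, hcρ⟩ := exists_lt_of_csInf_lt
      (s := {c : ℝ | 0 < c ∧ ∫⁻ ω, uhat (f ω / c) ∂P ≤ 1}) (hLUc f hf) hρ
    exact ⟨c, hc0, hcρ, hc1⟩
  have hNlt' : ∀ (f : Ω → ℝ) (ρ c : ℝ), 0 < c → c < ρ → ∫⁻ ω, uhat (f ω / c) ∂P ≤ 1 →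
      Nu f < ρ := by
    intro f ρ c hc0 hcρ hle
    rw [hNu]
    have hbdd : BddBelow {c : ℝ | 0 < c ∧ ∫⁻ ω, uhat (f ω / c) ∂P ≤ 1} :=
      ⟨0, fun x hx => hx.1.le⟩
    have hmem : c ∈ {c : ℝ | 0 < c ∧ ∫⁻ ω, uhat (f ω / c) ∂P ≤ 1} := ⟨hc0, hle⟩
    exact (csInf_le hbdd hmem).trans_lt hcρ
  have hsmul : ∀ f ∈ LU, ∀ t : ℝ, (fun ω => t * f ω) ∈ LU := by
    intro f hf t
    obtain ⟨hfm, α, hα, hlt⟩ := (hLU f).1 hf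
    refine (hLU _).2 ⟨hfm.const_mul t, α / (|t| + 1), by positivity, ?_⟩
    refine lt_of_le_of_lt (lintegral_mono fun ω => hmo _ _ ?_) hlt
    rw [abs_mul, abs_mul, abs_mul, abs_div, abs_of_pos hα, abs_of_pos (by positivity : 0 < |t| + 1),
      div_mul_eq_mul_div, div_le_iff₀ (by positivity)]
    have : 0 ≤ α * |f ω| := by positivity
    nlinarith
  have hadd : ∀ f ∈ LU, ∀ g ∈ LU, (fun ω => f ω + g ω) ∈ LU := by
    intro f hf g hg
    obtain ⟨hfm, α, hα, hlt⟩ := (hLU f).1 hf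
    obtain ⟨hgm, β, hβ, hlt'⟩ := (hLU g).1 hg
    refine (hLU _).2 ⟨hfm.add hgm, min α β / 2, by positivity, ?_⟩
    have key : ∀ ω, uhat (min α β / 2 * (f ω + g ω)) ≤ uhat (α * f ω) + uhat (β * g ω) := by
      intro ω
      have hm : 0 < min α β := lt_min hα hβ
      have h1 : |f ω + g ω| ≤ |f ω| + |g ω| := abs_add_le _ _
      have h2 : min α β * |f ω| ≤ α * |f ω| :=
        mul_le_mul_of_nonneg_right (min_le_left _ _) (abs_nonneg _)
      have h3 : min α β * |g ω| ≤ β * |g ω| :=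
        mul_le_mul_of_nonneg_right (min_le_right _ _) (abs_nonneg _)
      have h4 : min α β * |f ω + g ω| ≤ min α β * |f ω| + min α β * |g ω| := by
        rw [← mul_add]
        exact mul_le_mul_of_nonneg_left h1 hm.le
      rcases le_total (α * |f ω|) (β * |g ω|) with h | h
      · refine le_trans (hmo _ (β * g ω) ?_) le_add_self
        rw [abs_mul, abs_mul, abs_of_pos hβ, abs_of_pos (by positivity : 0 < min α β / 2)]
        linarith
      · refine le_trans (hmo _ (α * f ω) ?_) le_self_add
        rw [abs_mul, abs_mul, abs_of_pos hα, abs_of_pos (by positivity : 0 < min α β / 2)]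
        linarith
    refine lt_of_le_of_lt (lintegral_mono key) ?_
    rw [lintegral_add_left (by fun_prop)]
    exact ENNReal.add_lt_top.2 ⟨hlt, hlt'⟩
  have hDp : ∀ f ∈ D, (∀ᵐ ω ∂P, u (f ω) ≠ ⊥) ∧ Integrable (fun ω => (u (f ω)).toReal) P := by
    intro f hf
    obtain ⟨_, g, hg, hae⟩ := (hD f).1 hf
    refine ⟨?_, hg.congr ?_⟩
    · filter_upwards [hae] with ω hω
      rw [hω]
      exact EReal.coe_ne_bot _
    · filter_upwards [hae] with ω hω
      rw [hω, EReal.toReal_coe]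
  have claim1 : ∀ f ∈ LU, Nu f < 1 →
      f ∈ D ∧ Integrable f P ∧ Integrable (fun ω => (u (f ω)).toReal) P ∧
      (u 0).toReal - 1 ≤ ∫ ω, (u (f ω)).toReal ∂P ∧
      ((∫ ω, (u (f ω)).toReal ∂P : ℝ) : EReal) ≤ u (∫ ω, f ω ∂P) := by
    intro f hf hN
    obtain ⟨c, hc0, hc1, hle⟩ := hNlt f hf 1 hN
    obtain ⟨hS, h1, h2, h3⟩ := hball f c ((hLU f).1 hf).1 hc0 hc1 hle
    refine ⟨(hD f).2 ⟨hf, _, h2, ?_⟩, h1, h2, h3⟩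
    filter_upwards [hS] with ω hω
    rw [EReal.coe_toReal (hu_ne_top _) hω]
  have hzLU : (0 : Ω → ℝ) ∈ LU := (hLU _).2 ⟨measurable_zero, 1, one_pos, by simp [hz]⟩
  have hNz : ∀ ρ : ℝ, 0 < ρ → Nu 0 < ρ := fun ρ hρ =>
    hNlt' 0 ρ (ρ / 2) (by positivity) (by linarith) (by simp [hz])
  refine ⟨claim1, ⟨0, (claim1 0 hzLU (hNz 1 one_pos)).1, 1, one_pos, fun g hg hN =>
    (claim1 g hg (by simpa using hN)).1⟩, ?_⟩
  rintro f hf ⟨r, hr, hrD⟩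
  have hfD : f ∈ D := hrD f hf (by rw [sub_self]; exact hNz r hr)
  obtain ⟨hfS, hfI⟩ := hDp f hfD
  refine ⟨hfD, hfI, ?_⟩
  -- a point of `𝒟` beyond `f`
  obtain ⟨c, hc0, hcle⟩ := hLUc f hf
  set l : ℝ := r / (2 * c) with hl
  have hl0 : 0 < l := by positivity
  set F : Ω → ℝ := fun ω => (1 + l) * f ω with hF
  have hFD : F ∈ D := by
    refine hrD F (hsmul f hf _) (hNlt' _ r (r / 2) (by positivity) (by linarith) ?_)
    convert hcle using 4 with ω
    simp only [hF, Pi.sub_apply, hl]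
    field_simp
    ring
  obtain ⟨hFS, hFI⟩ := hDp F hFD
  set η : ℝ := min r (l / (1 + l)) with hη
  have hη0 : 0 < η := lt_min hr (by positivity)
  set L : ℝ := 1 / (1 + l) * (∫ ω, (u (F ω)).toReal ∂P) + l / (1 + l) * ((u 0).toReal - 1) with hL
  have hlower : ∀ g ∈ LU, Nu (g - f) < η → g ∈ D ∧ L ≤ ∫ ω, (u (g ω)).toReal ∂P := by
    intro g hg hN
    have hgD : g ∈ D := hrD g hg (hN.trans_le (min_le_left _ _))
    obtain ⟨hgS, hgI⟩ := hDp g hgD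
    refine ⟨hgD, ?_⟩
    have hgf : g - f ∈ LU := by
      have := hadd g hg _ (hsmul f hf (-1))
      convert this using 1
      funext ω
      simp [sub_eq_add_neg]
    obtain ⟨c', hc'0, hc'1, hc'le⟩ := hNlt _ hgf _ (hN.trans_le (min_le_right _ _))
    obtain ⟨hwS, _, hwI, hwle, _⟩ := hball (fun ω => (1 + l) / l * (g - f) ω)
      ((1 + l) / l * c') (((hLU _).1 hgf).1.const_mul _) (by positivity)
      (by
        calc (1 + l) / l * c' < (1 + l) / l * (l / (1 + l)) := by gcongr
          _ = 1 := by field_simp)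
      (by
        convert hc'le using 4 with ω
        field_simp)
    have h1 := OrliczAux.integral_concave P hc (p := g) (s := 1 / (1 + l)) (t := l / (1 + l))
      (by positivity) (by positivity) (by field_simp) hgI hFI hwI hFS hwS
      (by
        intro ω
        simp only [hF, Pi.sub_apply]
        field_simp
        ring)
    have h2 : l / (1 + l) * ((u 0).toReal - 1) ≤
        l / (1 + l) * ∫ ω, (u ((1 + l) / l * (g - f) ω)).toReal ∂P := by gcongr
    linarith
  have hC : L ≤ ∫ ω, (u (f ω)).toReal ∂P :=
    (hlower f hf (by rw [sub_self]; exact hNz η hη0)).2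
  intro ε hε
  set If : ℝ := ∫ ω, (u (f ω)).toReal ∂P with hIf
  have hC0 : 0 ≤ If - L := by linarith
  set s : ℝ := ε / (ε + (If - L) + 1) with hs
  have hs0 : 0 < s := by positivity
  have hs1 : s < 1 := by
    rw [hs, div_lt_one (by positivity)]
    linarith
  have hsC : s * (If - L) < ε := by
    rw [hs, div_mul_eq_mul_div, div_lt_iff₀ (by positivity)]
    nlinarith
  clear_value s
  refine ⟨s * η, by positivity, fun g hg hN => ?_⟩
  obtain ⟨hgD, -⟩ := hlower g hg (hN.trans_le (mul_le_of_le_one_left hη0.le hs1.le))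
  obtain ⟨hgS, hgI⟩ := hDp g hgD
  have hgf : g - f ∈ LU := by
    have := hadd g hg _ (hsmul f hf (-1))
    convert this using 1
    funext ω
    simp [sub_eq_add_neg]
  obtain ⟨c', hc'0, hc'1, hc'le⟩ := hNlt _ hgf _ hN
  have hc's : c' / s < η := by
    rw [div_lt_iff₀ hs0]
    linarith
  have hpm : ∀ σ : ℝ, |σ| = 1 → (fun ω => f ω + σ / s * (g - f) ω) ∈ D ∧
      L ≤ ∫ ω, (u (f ω + σ / s * (g - f) ω)).toReal ∂P := by
    intro σ hσ
    refine hlower _ (hadd f hf _ (hsmul _ hgf _)) (hNlt' _ η (c' / s) (by positivity) hc's ?_)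
    refine le_trans (lintegral_mono fun ω => hmo _ _ ?_) hc'le
    simp only [Pi.sub_apply, add_sub_cancel_left]
    rw [abs_div, abs_div, abs_mul, abs_div, abs_div, hσ, abs_of_pos hs0, abs_of_pos hc'0]
    apply le_of_eq
    field_simp
  obtain ⟨hpD, hpL⟩ := hpm 1 (by simp)
  obtain ⟨hnD, hnL⟩ := hpm (-1) (by simp)
  obtain ⟨hpS, hpI⟩ := hDp _ hpD
  obtain ⟨hnS, hnI⟩ := hDp _ hnD
  have h1 := OrliczAux.integral_concave P hc (p := g) (s := 1 - s) (t := s)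
    (by linarith) hs0.le (by ring) hgI hfI hpI hfS hpS
    (by
      intro ω
      simp only [Pi.sub_apply]
      field_simp
      ring)
  have h2 := OrliczAux.integral_concave P hc (p := f) (s := 1 / (1 + s)) (t := s / (1 + s))
    (by positivity) (by positivity) (by field_simp) hfI hgI hnI hgS hnS
    (by
      intro ω
      simp only [Pi.sub_apply]
      field_simp
      ring)
  rw [div_mul_eq_mul_div, div_mul_eq_mul_div, ← add_div, div_le_iff₀ (by positivity)] at h2
  have h3 := mul_le_mul_of_nonneg_left hpL hs0.le
  have h4 := mul_le_mul_of_nonneg_left hnL hs0.le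
  rw [abs_lt]
  constructor <;> nlinarith

end
end

section
/- Assume (A1) and (A2). Fix λ > 0 and let N be a convex set of pairs (η, s) with η ∈ L_Φ, E[η] > 0 and s ∈ [0, ∞) (here η plays the role of the density of the regular part of a dual variable and s the dual norm of its singular part, the dual norm being additive on positive singular functionals). Suppose (η*, s*) ∈ N minimizes the functional (η, s) ↦ E[Φ(λη)] + λs over N. Then η*·Φ'(λη*) ∈ L¹(P), and for every (η, s) ∈ N one has (η·Φ'(λη*))⁺ ∈ L¹(P) and, in the extended reals, E[η·(-Φ'(λη*))] - s ≤ E[η*·(-Φ'(λη*))] - s* (with the convention 0·Φ'(0) := 0 on {η* = 0}). -/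
open MeasureTheory Filter Set Topology
open scoped ENNReal

noncomputable section

/-- Extended-real-valued expectation: the lower integral of the positive part minus the lower
integral of the negative part. -/
def ewp {Ω : Type*} [MeasurableSpace Ω] (P : Measure Ω) (H : Ω → EReal) : EReal :=
  ((∫⁻ ω, (H ω).toENN ∂P : ℝ≥0∞) : EReal) - ((∫⁻ ω, (-(H ω)).toENN ∂P : ℝ≥0∞) : EReal)


theorem s8_tangent (a : EReal) (u : ℝ → EReal)
    (hu_ne_top : ∀ x : ℝ, u x ≠ ⊤)
    (hu_bot : ∀ x : ℝ, (x : EReal) < a → u x = ⊥)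
    (hu_fin : ∀ x : ℝ, a < (x : EReal) → u x ≠ ⊥)
    (hu_mono : Monotone u)
    (du : ℝ → ℝ)
    (hdu : ∀ x : ℝ, a < (x : EReal) → HasDerivAt (fun t : ℝ => (u t).toReal) (du x) x)
    (hdu_anti : StrictAntiOn du {x : ℝ | a < (x : EReal)})
    (x0 : ℝ) (hx0 : a < (x0 : EReal)) (x : ℝ) :
    u x ≤ (((u x0).toReal + du x0 * (x - x0) : ℝ) : EReal) := by
  have hconv : Convex ℝ {x : ℝ | a < (x : EReal)} := by
    apply Set.OrdConnected.convex
    constructor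
    intro p hp q hq r hr
    exact lt_of_lt_of_le hp (EReal.coe_le_coe_iff.2 hr.1)
  have hopen : IsOpen {x : ℝ | a < (x : EReal)} :=
    isOpen_lt continuous_const continuous_coe_real_ereal
  have hcc : ConcaveOn ℝ {x : ℝ | a < (x : EReal)} (fun t : ℝ => (u t).toReal) := by
    apply AntitoneOn.concaveOn_of_deriv hconv
    · intro p hp
      exact (hdu p hp).continuousAt.continuousWithinAt
    · rw [hopen.interior_eq]
      intro p hp
      exact (hdu p hp).differentiableAt.differentiableWithinAt
    · rw [hopen.interior_eq]
      intro p hp q hq hpq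
      rw [(hdu p hp).deriv, (hdu q hq).deriv]
      exact hdu_anti.antitoneOn hp hq hpq
  have key : ∀ z : ℝ, a < (z : EReal) →
      u z ≤ (((u x0).toReal + du x0 * (z - x0) : ℝ) : EReal) := by
    intro z hz
    rw [← EReal.coe_toReal (hu_ne_top z) (hu_fin z hz), EReal.coe_le_coe_iff]
    rcases lt_trichotomy z x0 with h | h | h
    · have := hcc.le_slope_of_hasDerivAt hz hx0 h (hdu x0 hx0)
      rw [slope_def_field, le_div_iff₀ (by linarith)] at this
      linarith
    · subst h; simp
    · have := hcc.slope_le_of_hasDerivAt hx0 hz h (hdu x0 hx0)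
      rw [slope_def_field, div_le_iff₀ (by linarith)] at this
      linarith
  rcases lt_trichotomy (x : EReal) a with h | h | h
  · rw [hu_bot x h]; exact bot_le
  · have ht : Tendsto (fun z : ℝ => (((u x0).toReal + du x0 * (z - x0) : ℝ) : EReal)) (𝓝[>] x)
        (𝓝 (((u x0).toReal + du x0 * (x - x0) : ℝ) : EReal)) := by
      apply Tendsto.mono_left _ nhdsWithin_le_nhds
      apply Continuous.tendsto
      exact continuous_coe_real_ereal.comp (by fun_prop)
    refine ge_of_tendsto ht ?_
    filter_upwards [self_mem_nhdsWithin] with z hz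
    exact (hu_mono (le_of_lt hz)).trans (key z (by rw [← h]; exact EReal.coe_lt_coe_iff.2 hz))
  · exact key x h

theorem s8_le_iff (u : ℝ → EReal) (Phi : ℝ → EReal)
    (hPhi : ∀ y : ℝ, Phi y = ⨆ x : ℝ, (u x - ((x * y : ℝ) : EReal))) (y c : ℝ) :
    Phi y ≤ (c : EReal) ↔ ∀ x, u x ≤ ((c + x * y : ℝ) : EReal) := by
  rw [hPhi, iSup_le_iff]
  refine forall_congr' fun x => ?_
  rw [EReal.sub_le_iff_le_add (.inl (EReal.coe_ne_bot _)) (.inl (EReal.coe_ne_top _)),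
    EReal.coe_add]

/-- The analytic facts about the conjugate. -/
theorem s8_phi (a : EReal) (ha : a < 0) (u : ℝ → EReal)
    (hu_ne_top : ∀ x : ℝ, u x ≠ ⊤)
    (hu_bot : ∀ x : ℝ, (x : EReal) < a → u x = ⊥)
    (hu_fin : ∀ x : ℝ, a < (x : EReal) → u x ≠ ⊥)
    (hu_mono : Monotone u)
    (du : ℝ → ℝ)
    (hdu : ∀ x : ℝ, a < (x : EReal) → HasDerivAt (fun t : ℝ => (u t).toReal) (du x) x)
    (hdu_pos : ∀ x : ℝ, a < (x : EReal) → 0 < du x)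
    (hdu_anti : StrictAntiOn du {x : ℝ | a < (x : EReal)})
    (hdu_inada_top : ∀ M : ℝ, ∃ x : ℝ, a < (x : EReal) ∧ M ≤ du x)
    (hdu_inada_zero : Tendsto du atTop (𝓝 0))
    (Phi : ℝ → EReal)
    (hPhi : ∀ y : ℝ, Phi y = ⨆ x : ℝ, (u x - ((x * y : ℝ) : EReal))) :
    (∀ y, Phi y ≠ ⊥) ∧ (∀ y, Phi y ≠ ⊤ → (u 0).toReal ≤ (Phi y).toReal) ∧
    (∀ y, 0 < y → Phi y ≠ ⊤) ∧
    ConvexOn ℝ {y | Phi y ≠ ⊤} (fun y => (Phi y).toReal) ∧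
    (Phi 0 ≠ ⊤ → ∀ M : ℝ, ∃ δ > 0, ∀ y, 0 < y → y ≤ δ →
      (Phi y).toReal ≤ (Phi 0).toReal - M * y) := by
  have htan := s8_tangent a u hu_ne_top hu_bot hu_fin hu_mono du hdu hdu_anti
  have hle := s8_le_iff u Phi hPhi
  have ha0 : a < ((0 : ℝ) : EReal) := by simpa using ha
  have hlow : ∀ y, u 0 ≤ Phi y := by
    intro y
    rw [hPhi]
    refine le_trans ?_ (le_iSup _ (0 : ℝ))
    simp
  have hnb : ∀ y, Phi y ≠ ⊥ := by
    intro y h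
    have := hlow y
    rw [h, le_bot_iff] at this
    exact hu_fin 0 ha0 this
  have hco : ∀ y, Phi y ≠ ⊤ → (((Phi y).toReal : ℝ) : EReal) = Phi y :=
    fun y h => EReal.coe_toReal h (hnb y)
  have hub : ∀ y, Phi y ≠ ⊤ → ∀ x, u x ≤ (((Phi y).toReal + x * y : ℝ) : EReal) := by
    intro y h
    exact (hle y _).1 (hco y h).symm.le.ge.le
  have hfin : ∀ y, 0 < y → Phi y ≠ ⊤ := by
    intro y hy
    obtain ⟨x1, hx1, hx1y⟩ := hdu_inada_top y
    obtain ⟨x2, hx2y, hx2⟩ :=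
      ((hdu_inada_zero.eventually (gt_mem_nhds hy)).and (eventually_ge_atTop x1)).exists
    have hx2a : a < (x2 : EReal) := lt_of_lt_of_le hx1 (EReal.coe_le_coe_iff.2 hx2)
    have : Phi y ≤ ((max ((u x1).toReal - x1 * y) ((u x2).toReal - x1 * y) : ℝ) : EReal) := by
      rw [hle]
      intro x
      rcases le_total x x1 with h | h
      · refine (htan x1 hx1 x).trans (EReal.coe_le_coe_iff.2 ?_)
        have := le_max_left ((u x1).toReal - x1 * y) ((u x2).toReal - x1 * y)
        nlinarith
      · have h3 := le_max_right ((u x1).toReal - x1 * y) ((u x2).toReal - x1 * y)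
        rcases le_total x x2 with h' | h'
        · refine (hu_mono h').trans ?_
          refine (EReal.coe_toReal (hu_ne_top x2) (hu_fin x2 hx2a)).symm.le.trans
            (EReal.coe_le_coe_iff.2 ?_)
          nlinarith
        · refine (htan x2 hx2a x).trans (EReal.coe_le_coe_iff.2 ?_)
          nlinarith
    exact ne_top_of_le_ne_top (EReal.coe_ne_top _) this
  have hcomb : ∀ y z s t : ℝ, Phi y ≠ ⊤ → Phi z ≠ ⊤ → 0 ≤ s → 0 ≤ t → s + t = 1 →
      Phi (s * y + t * z) ≤ ((s * (Phi y).toReal + t * (Phi z).toReal : ℝ) : EReal) := by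
    intro y z s t hy hz hs ht hst
    rw [hle]
    intro x
    by_cases hx : u x = ⊥
    · rw [hx]; exact bot_le
    have h1 := hub y hy x
    have h2 := hub z hz x
    rw [← EReal.coe_toReal (hu_ne_top x) hx, EReal.coe_le_coe_iff] at h1 h2 ⊢
    have h3 := mul_le_mul_of_nonneg_left h1 hs
    have h4 := mul_le_mul_of_nonneg_left h2 ht
    have : (u x).toReal = s * (u x).toReal + t * (u x).toReal := by rw [← add_mul, hst, one_mul]
    nlinarith
  refine ⟨hnb, ?_, hfin, ⟨?_, ?_⟩, ?_⟩
  · intro y hy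
    exact EReal.toReal_le_toReal (hlow y) (hu_fin 0 ha0) hy
  · intro y hy z hz s t hs ht hst
    exact ne_top_of_le_ne_top (EReal.coe_ne_top _) (hcomb y z s t hy hz hs ht hst)
  · intro y hy z hz s t hs ht hst
    have h := hcomb y z s t hy hz hs ht hst
    rw [← hco _ (ne_top_of_le_ne_top (EReal.coe_ne_top _) h), EReal.coe_le_coe_iff] at h
    exact h
  · intro h0 M
    set K := max M 0
    have hK : a < (K : EReal) := lt_of_lt_of_le ha0 (EReal.coe_le_coe_iff.2 (le_max_right _ _))
    refine ⟨du K, hdu_pos K hK, fun y hy hyd => ?_⟩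
    have h : Phi y ≤ (((Phi 0).toReal - K * y : ℝ) : EReal) := by
      rw [hle]
      intro x
      rcases le_total x K with h | h
      · refine (htan K hK x).trans (EReal.coe_le_coe_iff.2 ?_)
        have := hub 0 h0 K
        rw [← EReal.coe_toReal (hu_ne_top K) (hu_fin K hK), EReal.coe_le_coe_iff] at this
        nlinarith
      · refine (hub 0 h0 x).trans (EReal.coe_le_coe_iff.2 ?_)
        nlinarith
    rw [← hco _ (hfin y hy), EReal.coe_le_coe_iff] at h
    have : M ≤ K := le_max_left _ _
    nlinarith

theorem s8_toENN_coe (r : ℝ) : ((r : EReal)).toENN = ENNReal.ofReal r := by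
  simp [EReal.toENN]

theorem s8_ewp {Ω : Type*} [MeasurableSpace Ω] (P : Measure Ω) (H : Ω → EReal) (f : Ω → ℝ)
    (hf : Integrable f P) (hH : ∀ᵐ ω ∂P, H ω = (f ω : EReal)) :
    ewp P H = ((∫ ω, f ω ∂P : ℝ) : EReal) := by
  have h1 : ∫⁻ ω, (H ω).toENN ∂P = ∫⁻ ω, ENNReal.ofReal (f ω) ∂P := by
    apply lintegral_congr_ae
    filter_upwards [hH] with ω h
    rw [h, s8_toENN_coe]
  have h2 : ∫⁻ ω, (-(H ω)).toENN ∂P = ∫⁻ ω, ENNReal.ofReal (-(f ω)) ∂P := by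
    apply lintegral_congr_ae
    filter_upwards [hH] with ω h
    rw [h, ← EReal.coe_neg, s8_toENN_coe]
  have f1 : ∫⁻ ω, ENNReal.ofReal (f ω) ∂P ≠ ⊤ := hf.lintegral_lt_top.ne
  have f2 : ∫⁻ ω, ENNReal.ofReal (-(f ω)) ∂P ≠ ⊤ := hf.neg.lintegral_lt_top.ne
  rw [ewp, h1, h2, integral_eq_lintegral_pos_part_sub_lintegral_neg_part hf, EReal.coe_sub,
    EReal.coe_ennreal_toReal f1, EReal.coe_ennreal_toReal f2]

theorem s8_meas_comp {Ω : Type*} [MeasurableSpace Ω] {φ : ℝ → ℝ} (d : ℝ → ℝ)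
    (hd : ∀ y, 0 < y → HasDerivAt φ (d y) y) {g : Ω → ℝ} (hg : Measurable g)
    (hg0 : ∀ ω, 0 ≤ g ω) : Measurable (fun ω => φ (g ω)) := by
  classical
  have h1 : Measurable ((Ioi (0 : ℝ)).piecewise φ (fun _ => φ 0)) :=
    ContinuousOn.measurable_piecewise
      (fun y hy => (hd y hy).continuousAt.continuousWithinAt) continuousOn_const measurableSet_Ioi
  have h2 : (fun ω => φ (g ω)) = fun ω => (Ioi (0 : ℝ)).piecewise φ (fun _ => φ 0) (g ω) := by
    funext ω
    by_cases h : 0 < g ω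
    · rw [Set.piecewise_eq_of_mem _ _ _ (mem_Ioi.2 h)]
    · rw [Set.piecewise_eq_of_notMem _ _ _ (by simpa using h)]
      rw [le_antisymm (not_lt.1 h) (hg0 ω)]
  rw [h2]
  exact h1.comp hg

/-- Integrability of `Φ(g)`. -/
theorem s8_int {Ω : Type*} [MeasurableSpace Ω] (P : Measure Ω) [IsProbabilityMeasure P]
    (Phi : ℝ → EReal) (c : ℝ) (hnb : ∀ y, Phi y ≠ ⊥) (hlow : ∀ y, Phi y ≠ ⊤ → c ≤ (Phi y).toReal)
    (hfin : ∀ y, 0 < y → Phi y ≠ ⊤) (d : ℝ → ℝ)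
    (hd : ∀ y : ℝ, 0 < y → HasDerivAt (fun t : ℝ => (Phi t).toReal) (d y) y)
    {g : Ω → ℝ} (hg : Measurable g) (hg0 : ∀ ω, 0 ≤ g ω)
    (hI : ∫⁻ ω, (Phi (g ω)).toENN ∂P < ⊤) :
    (∀ᵐ ω ∂P, Phi (g ω) ≠ ⊤) ∧ Integrable (fun ω => (Phi (g ω)).toReal) P := by
  have hm := s8_meas_comp d hd hg hg0
  have hae : ∀ᵐ ω ∂P, Phi (g ω) ≠ ⊤ := by
    by_cases h0 : Phi 0 = ⊤
    · have hm2 : Measurable (fun ω => (Phi (g ω)).toENN) := by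
        have : (fun ω => (Phi (g ω)).toENN) = fun ω => if g ω = 0 then ⊤ else
            ENNReal.ofReal (Phi (g ω)).toReal := by
          funext ω
          by_cases h : g ω = 0
          · simp [h, h0, EReal.toENN]
          · simp [h, EReal.toENN, hfin _ (lt_of_le_of_ne (hg0 ω) (Ne.symm h))]
        rw [this]
        exact Measurable.ite (hg (measurableSet_singleton 0)) measurable_const hm.ennreal_ofReal
      filter_upwards [ae_lt_top hm2 hI.ne] with ω hω h
      simp [EReal.toENN, h] at hω
    · refine ae_of_all _ fun ω => ?_
      rcases (hg0 ω).eq_or_lt with h | h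
      · rw [← h]; exact h0
      · exact hfin _ h
  refine ⟨hae, hm.aestronglyMeasurable, ?_⟩
  have hb : ∫⁻ ω, ENNReal.ofReal |(Phi (g ω)).toReal| ∂P ≤
      ∫⁻ ω, ((Phi (g ω)).toENN + ENNReal.ofReal |c|) ∂P := by
    apply lintegral_mono_ae
    filter_upwards [hae] with ω h
    have h1 := hlow _ h
    rw [EReal.toENN, if_neg h]
    rcases le_total 0 (Phi (g ω)).toReal with h2 | h2
    · rw [abs_of_nonneg h2]; exact le_self_add
    · refine le_trans (ENNReal.ofReal_le_ofReal ?_) le_add_self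
      rw [abs_of_nonpos h2]
      have := neg_abs_le c
      linarith
  rw [HasFiniteIntegral]
  simp_rw [← ofReal_norm, Real.norm_eq_abs]
  refine lt_of_le_of_lt hb ?_
  rw [lintegral_add_right _ measurable_const]
  simp [hI]

theorem s8_tan {φ : ℝ → ℝ} {D : Set ℝ} (hc : ConvexOn ℝ D φ) {y z d : ℝ} (hy : y ∈ D) (hz : z ∈ D)
    (hd : HasDerivAt φ d y) : d * (z - y) ≤ φ z - φ y := by
  rcases lt_trichotomy z y with h | h | h
  · have := hc.slope_le_of_hasDerivAt hz hy h hd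
    rw [slope_def_field, div_le_iff₀ (by linarith)] at this
    linarith
  · subst h; simp
  · have := hc.le_slope_of_hasDerivAt hy hz h hd
    rwa [slope_def_field, le_div_iff₀ (by linarith)] at this

theorem s8_measA {Ω : Type*} [MeasurableSpace Ω] {φ : ℝ → ℝ} (d : ℝ → ℝ)
    (hd : ∀ y, 0 < y → HasDerivAt φ (d y) y) (lam : ℝ) (hlam : 0 < lam)
    {e h : Ω → ℝ} (he : Measurable e) (he0 : ∀ ω, 0 ≤ e ω) (hh : Measurable h) :
    Measurable (fun ω => if e ω = 0 then 0 else h ω * d (lam * e ω)) := by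
  have : (fun ω => if e ω = 0 then 0 else h ω * d (lam * e ω)) =
      fun ω => if e ω = 0 then 0 else h ω * deriv φ (lam * e ω) := by
    funext ω
    by_cases h0 : e ω = 0
    · simp [h0]
    · rw [if_neg h0, if_neg h0, (hd _ (mul_pos hlam (lt_of_le_of_ne (he0 ω) (Ne.symm h0)))).deriv]
  rw [this]
  exact Measurable.ite (he (measurableSet_singleton 0)) measurable_const
    (hh.mul ((measurable_deriv φ).comp (he.const_mul lam)))

theorem s8_intA {Ω : Type*} [MeasurableSpace Ω] (P : Measure Ω) {φ : ℝ → ℝ} {D : Set ℝ}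
    (hc : ConvexOn ℝ D φ) (hD : ∀ y, 0 < y → y ∈ D) (d : ℝ → ℝ)
    (hd : ∀ y, 0 < y → HasDerivAt φ (d y) y) (lam : ℝ) (hlam : 0 < lam)
    {e : Ω → ℝ} (he : Measurable e) (he0 : ∀ ω, 0 ≤ e ω)
    (hI : ∀ l, 0 < l → Integrable (fun ω => φ (l * e ω)) P) :
    Integrable (fun ω => if e ω = 0 then 0 else e ω * d (lam * e ω)) P := by
  have hB : Integrable (fun ω => lam⁻¹ * (|φ (2 * lam * e ω) - φ (lam * e ω)| +
      2 * |φ (lam / 2 * e ω) - φ (lam * e ω)|)) P :=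
    ((((hI (2 * lam) (by positivity)).sub (hI lam hlam)).abs).add
      ((((hI (lam / 2) (by positivity)).sub (hI lam hlam)).abs).const_mul 2)).const_mul lam⁻¹
  refine hB.mono' (s8_measA d hd lam hlam he he0 he).aestronglyMeasurable (ae_of_all _ fun ω => ?_)
  by_cases h0 : e ω = 0
  · simp only [h0, if_true, norm_zero]
    positivity
  have hpos : 0 < e ω := lt_of_le_of_ne (he0 ω) (Ne.symm h0)
  have hy : 0 < lam * e ω := mul_pos hlam hpos
  rw [if_neg h0, Real.norm_eq_abs, inv_mul_eq_div, le_div_iff₀ hlam]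
  have t1 := s8_tan hc (hD _ hy) (hD (2 * lam * e ω) (by positivity)) (hd _ hy)
  have t2 := s8_tan hc (hD _ hy) (hD (lam / 2 * e ω) (by positivity)) (hd _ hy)
  have a1 := le_abs_self (φ (2 * lam * e ω) - φ (lam * e ω))
  have a2 := le_abs_self (φ (lam / 2 * e ω) - φ (lam * e ω))
  have b1 := abs_nonneg (φ (2 * lam * e ω) - φ (lam * e ω))
  have b2 := abs_nonneg (φ (lam / 2 * e ω) - φ (lam * e ω))
  have : |e ω * d (lam * e ω)| * lam = |e ω * d (lam * e ω) * lam| := by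
    rw [abs_mul _ lam, abs_of_pos hlam]
  rw [this, abs_le]
  constructor <;> nlinarith

/-- The Fatou step. -/
theorem s8_fatou {Ω : Type*} [MeasurableSpace Ω] (P : Measure Ω) {φ : ℝ → ℝ} {D : Set ℝ}
    (hc : ConvexOn ℝ D φ) (hD : ∀ y, 0 < y → y ∈ D) (d : ℝ → ℝ)
    (hd : ∀ y, 0 < y → HasDerivAt φ (d y) y)
    (h0 : 0 ∈ D → ∀ M : ℝ, ∃ δ > 0, ∀ y, 0 < y → y ≤ δ → φ y ≤ φ 0 - M * y)
    (lam : ℝ) (hlam : 0 < lam) (s sS : ℝ)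
    {e h : Ω → ℝ} (he : Measurable e) (he0 : ∀ ω, 0 ≤ e ω)
    (hh : Measurable h) (hh0 : ∀ ω, 0 ≤ h ω)
    (heD : ∀ᵐ ω ∂P, lam * e ω ∈ D) (hhD : ∀ᵐ ω ∂P, lam * h ω ∈ D)
    (heI : Integrable (fun ω => φ (lam * e ω)) P)
    (hhI : Integrable (fun ω => φ (lam * h ω)) P)
    (hmI : ∀ t : ℝ, 0 < t → t ≤ 1 → Integrable (fun ω => φ (lam * (e ω + t * (h ω - e ω)))) P)
    (hmin : ∀ t : ℝ, 0 < t → t ≤ 1 →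
      ∫ ω, φ (lam * e ω) ∂P + lam * sS ≤
        ∫ ω, φ (lam * (e ω + t * (h ω - e ω))) ∂P + lam * (sS + t * (s - sS))) :
    (∀ᵐ ω ∂P, e ω = 0 → h ω = 0) ∧
    Integrable (fun ω => if e ω = 0 then 0 else (h ω - e ω) * d (lam * e ω)) P ∧
    sS - s ≤ ∫ ω, (if e ω = 0 then 0 else (h ω - e ω) * d (lam * e ω)) ∂P := by
  set t : ℕ → ℝ := fun n => 1 / ((n : ℝ) + 1) with ht
  have ht0 : ∀ n, 0 < t n := fun n => Nat.one_div_pos_of_nat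
  have ht1 : ∀ n, t n ≤ 1 := by
    intro n
    rw [ht]
    simp only
    rw [div_le_one (by positivity)]
    have : (0 : ℝ) ≤ n := Nat.cast_nonneg n
    linarith
  have htt : Tendsto t atTop (𝓝 0) := tendsto_one_div_add_atTop_nhds_zero_nat
  set q : ℕ → Ω → ℝ := fun n ω =>
    (t n)⁻¹ * (φ (lam * (e ω + t n * (h ω - e ω))) - φ (lam * e ω)) with hq
  set G : ℕ → Ω → ℝ := fun n ω => (φ (lam * h ω) - φ (lam * e ω)) - q n ω with hG
  have hqI : ∀ n, Integrable (q n) P := fun n =>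
    ((hmI (t n) (ht0 n) (ht1 n)).sub heI).const_mul _
  have hGI : ∀ n, Integrable (G n) P := fun n => (hhI.sub heI).sub (hqI n)
  have hm0 : ∀ n ω, 0 ≤ e ω + t n * (h ω - e ω) := by
    intro n ω
    have := he0 ω; have := hh0 ω; have := ht0 n; have := ht1 n
    nlinarith [mul_nonneg (ht0 n).le (hh0 ω), mul_nonneg (sub_nonneg.2 (ht1 n)) (he0 ω)]
  have hGm : ∀ n, Measurable (G n) := by
    intro n
    have m1 := s8_meas_comp d hd (he.const_mul lam) (fun ω => mul_nonneg hlam.le (he0 ω))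
    have m2 := s8_meas_comp d hd (hh.const_mul lam) (fun ω => mul_nonneg hlam.le (hh0 ω))
    have m3 := s8_meas_comp d hd (g := fun ω => lam * (e ω + t n * (h ω - e ω)))
      ((he.add ((hh.sub he).const_mul _)).const_mul lam)
      (fun ω => mul_nonneg hlam.le (hm0 n ω))
    exact (m2.sub m1).sub ((m3.sub m1).const_mul _)
  have hG0 : ∀ n, ∀ᵐ ω ∂P, 0 ≤ G n ω := by
    intro n
    filter_upwards [heD, hhD] with ω h1 h2
    have := hc.2 h1 h2 (sub_nonneg.2 (ht1 n)) (ht0 n).le (by ring)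
    simp only [smul_eq_mul] at this
    have e1 : (1 - t n) * (lam * e ω) + t n * (lam * h ω) =
      lam * (e ω + t n * (h ω - e ω)) := by ring
    rw [e1] at this
    simp only [hG, hq]
    rw [sub_nonneg, inv_mul_eq_div, div_le_iff₀ (ht0 n)]
    linarith
  set C : ℝ := ∫ ω, (φ (lam * h ω) - φ (lam * e ω)) ∂P - lam * (sS - s) with hC
  have hGC : ∀ n, ∫ ω, G n ω ∂P ≤ C := by
    intro n
    have h1 : ∫ ω, G n ω ∂P = ∫ ω, (φ (lam * h ω) - φ (lam * e ω)) ∂P - ∫ ω, q n ω ∂P :=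
      integral_sub (hhI.sub heI) (hqI n)
    have h2 : ∫ ω, q n ω ∂P = (t n)⁻¹ * (∫ ω, φ (lam * (e ω + t n * (h ω - e ω))) ∂P
        - ∫ ω, φ (lam * e ω) ∂P) := by
      rw [hq]
      simp only
      rw [integral_const_mul, integral_sub (hmI (t n) (ht0 n) (ht1 n)) heI]
    have h3 := hmin (t n) (ht0 n) (ht1 n)
    have h4 : lam * (sS - s) ≤ ∫ ω, q n ω ∂P := by
      rw [h2, inv_mul_eq_div, le_div_iff₀ (ht0 n)]
      linarith
    rw [h1, hC]; linarith
  have hGC' : ∀ n, ∫⁻ ω, ENNReal.ofReal (G n ω) ∂P ≤ ENNReal.ofReal C := by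
    intro n
    rw [← ofReal_integral_eq_lintegral_ofReal (hGI n) (hG0 n)]
    exact ENNReal.ofReal_le_ofReal (hGC n)
  have hF : ∫⁻ ω, liminf (fun n => ENNReal.ofReal (G n ω)) atTop ∂P ≤ ENNReal.ofReal C := by
    refine (lintegral_liminf_le (fun n => (hGm n).ennreal_ofReal)).trans ?_
    refine (liminf_le_liminf (v := fun _ => ENNReal.ofReal C)
      (Eventually.of_forall hGC')).trans ?_
    simp
  have hfin := ae_lt_top (Measurable.liminf (fun n => (hGm n).ennreal_ofReal))
    (ne_top_of_le_ne_top ENNReal.ofReal_ne_top hF)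
  have hzero : ∀ᵐ ω ∂P, e ω = 0 → h ω = 0 := by
    filter_upwards [hfin, heD] with ω h1 h2 h3
    by_contra h4
    have hp : 0 < lam * h ω := mul_pos hlam (lt_of_le_of_ne (hh0 ω) (Ne.symm h4))
    rw [h3, mul_zero] at h2
    have hT : Tendsto (fun n => G n ω) atTop atTop := by
      rw [tendsto_atTop]
      intro b
      obtain ⟨δ, hδ, hδ'⟩ := h0 h2 ((b - (φ (lam * h ω) - φ 0)) / (lam * h ω))
      have : ∀ᶠ n in atTop, t n * (lam * h ω) < δ := by
        have h5 : Tendsto (fun n => t n * (lam * h ω)) atTop (𝓝 (0 * (lam * h ω))) :=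
          htt.mul_const _
        rw [zero_mul] at h5
        exact h5.eventually (gt_mem_nhds hδ)
      filter_upwards [this] with n hn
      have h6 := hδ' (t n * (lam * h ω)) (mul_pos (ht0 n) hp) hn.le
      simp only [hG, hq, h3]
      have e1 : lam * (0 + t n * (h ω - 0)) = t n * (lam * h ω) := by ring
      have e2 : (b - (φ (lam * h ω) - φ 0)) / (lam * h ω) * (t n * (lam * h ω)) =
        (b - (φ (lam * h ω) - φ 0)) * t n := by field_simp
      rw [e2] at h6
      rw [e1, mul_zero, le_sub_comm, inv_mul_eq_div, div_le_iff₀ (ht0 n)]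
      linarith
    have hT2 := (ENNReal.tendsto_ofReal_atTop.comp hT).liminf_eq
    simp only [Function.comp_def] at hT2
    rw [hT2] at h1
    exact lt_irrefl _ h1
  set W : Ω → ℝ := fun ω => if e ω = 0 then 0 else (h ω - e ω) * d (lam * e ω) with hW
  have hWm : Measurable W := s8_measA d hd lam hlam he he0 (hh.sub he)
  set R : Ω → ℝ := fun ω => (φ (lam * h ω) - φ (lam * e ω)) - lam * W ω with hR
  have hlim : ∀ᵐ ω ∂P, Tendsto (fun n => G n ω) atTop (𝓝 (R ω)) := by
    filter_upwards [hzero] with ω h1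
    by_cases h2 : e ω = 0
    · simp [hG, hR, hW, hq, h2, h1 h2]
    · have hp : 0 < lam * e ω := mul_pos hlam (lt_of_le_of_ne (he0 ω) (Ne.symm h2))
      have hder := hd _ hp
      have hder2 : HasDerivAt (fun x : ℝ => φ (lam * (e ω + x * (h ω - e ω))))
          (d (lam * e ω) * (lam * (h ω - e ω))) 0 := by
        have hin : HasDerivAt (fun x : ℝ => lam * (e ω + x * (h ω - e ω)))
            (lam * (h ω - e ω)) 0 := by
          have := (((hasDerivAt_id (0 : ℝ)).mul_const (h ω - e ω)).const_add (e ω)).const_mul lam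
          simpa using this
        have hder' : HasDerivAt φ (d (lam * e ω)) (lam * (e ω + 0 * (h ω - e ω))) := by
          simpa using hder
        exact hder'.comp (0 : ℝ) hin
      have h3 := hder2.tendsto_slope_zero
      have h4 : Tendsto t atTop (𝓝[≠] 0) :=
        tendsto_nhdsWithin_iff.2 ⟨htt, Eventually.of_forall fun n => (ht0 n).ne'⟩
      have h5 := h3.comp h4
      have h6 : Tendsto (fun n => q n ω) atTop (𝓝 (lam * W ω)) := by
        have e1 : lam * W ω = d (lam * e ω) * (lam * (h ω - e ω)) := by
          simp only [hW, h2, if_false]; ring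
        rw [e1]
        refine h5.congr fun n => ?_
        simp [hq]
      exact tendsto_const_nhds.sub h6
  have hG0' := ae_all_iff.2 hG0
  have hR0 : ∀ᵐ ω ∂P, 0 ≤ R ω := by
    filter_upwards [hlim, hG0'] with ω h1 h2
    exact ge_of_tendsto h1 (Eventually.of_forall h2)
  have hRl : ∫⁻ ω, ENNReal.ofReal (R ω) ∂P ≤ ENNReal.ofReal C := by
    refine le_trans (le_of_eq (lintegral_congr_ae ?_)) hF
    filter_upwards [hlim] with ω h1
    exact (ENNReal.tendsto_ofReal h1).liminf_eq.symm
  have hRm : AEStronglyMeasurable R P :=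
    (hhI.sub heI).aestronglyMeasurable.sub (hWm.const_mul lam).aestronglyMeasurable
  have hRI : Integrable R P := by
    refine ⟨hRm, ?_⟩
    rw [hasFiniteIntegral_iff_ofReal hR0]
    exact lt_of_le_of_lt hRl ENNReal.ofReal_lt_top
  have hC0 : 0 ≤ C := (integral_nonneg_of_ae (hG0 0)).trans (hGC 0)
  have hRC : ∫ ω, R ω ∂P ≤ C := by
    rw [← ofReal_integral_eq_lintegral_ofReal hRI hR0] at hRl
    exact (ENNReal.ofReal_le_ofReal_iff hC0).1 hRl
  have hWI : Integrable W P := by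
    have : Integrable (fun ω => lam⁻¹ * ((φ (lam * h ω) - φ (lam * e ω)) - R ω)) P :=
      ((hhI.sub heI).sub hRI).const_mul _
    refine this.congr (ae_of_all _ fun ω => ?_)
    simp only [hR]
    field_simp
    ring
  refine ⟨hzero, hWI, ?_⟩
  have h1 : ∫ ω, R ω ∂P = ∫ ω, (φ (lam * h ω) - φ (lam * e ω)) ∂P - lam * ∫ ω, W ω ∂P := by
    rw [← integral_const_mul]
    exact integral_sub (hhI.sub heI) (hWI.const_mul lam)
  rw [h1, hC] at hRC
  have : lam * (sS - s) ≤ lam * ∫ ω, W ω ∂P := by linarith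
  exact le_of_mul_le_mul_left this hlam

/-- Proposition 25.  Assume (A1) and (A2), fix `λ > 0` and let `N` be a
convex set of pairs `(η, s)` with `η ∈ L_Φ`, `E[η] > 0`, `s ∈ [0, ∞)`.  If `(η*, s*) ∈ N`
minimizes `(η, s) ↦ E[Φ(λη)] + λs` over `N`, then `η*·Φ'(λη*) ∈ L¹(P)` and, for every
`(η, s) ∈ N`, `(η·Φ'(λη*))⁺ ∈ L¹(P)` and, in the extended reals,
`E[η·(-Φ'(λη*))] - s ≤ E[η*·(-Φ'(λη*))] - s*` (with `0·Φ'(0) := 0` on `{η* = 0}`). -/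
theorem statement8
    {Ω : Type*} [MeasurableSpace Ω] (P : Measure Ω) [IsProbabilityMeasure P]
    (a : EReal) (ha : a < 0)
    (u : ℝ → EReal)
    (hu_ne_top : ∀ x : ℝ, u x ≠ ⊤)
    (hu_bot : ∀ x : ℝ, (x : EReal) < a → u x = ⊥)
    (hu_fin : ∀ x : ℝ, a < (x : EReal) → u x ≠ ⊥)
    (hu_mono : Monotone u)
    (hu_lim : Tendsto u atBot (𝓝 ⊥))
    -- (A1): `u` is continuously differentiable on `(a, ∞)` with derivative `du` …
    (du : ℝ → ℝ)
    (hdu : ∀ x : ℝ, a < (x : EReal) → HasDerivAt (fun t : ℝ => (u t).toReal) (du x) x)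
    (hdu_cont : ContinuousOn du {x : ℝ | a < (x : EReal)})
    (hdu_pos : ∀ x : ℝ, a < (x : EReal) → 0 < du x)
    -- … `u` is strictly concave (its derivative is strictly decreasing) …
    (hdu_anti : StrictAntiOn du {x : ℝ | a < (x : EReal)})
    -- … and the Inada conditions `u'(a) = +∞` and `u'(∞) = 0` hold
    (hdu_inada_top : ∀ M : ℝ, ∃ x : ℝ, a < (x : EReal) ∧ M ≤ du x)
    (hdu_inada_zero : Tendsto du atTop (𝓝 0))
    -- the convex conjugate `Φ(y) = sup_x (u(x) - x·y)`
    (Phi : ℝ → EReal)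
    (hPhi : ∀ y : ℝ, Phi y = ⨆ x : ℝ, (u x - ((x * y : ℝ) : EReal)))
    -- (A2): `L_Φ = {g ≥ 0 : E[Φ(g)] < ∞}` is a cone
    (hA2 : ∀ g : Ω → ℝ, Measurable g → (∀ ω, 0 ≤ g ω) →
      ∫⁻ ω, (Phi (g ω)).toENN ∂P < ⊤ →
      ∀ l : ℝ, 0 < l → ∫⁻ ω, (Phi (l * g ω)).toENN ∂P < ⊤)
    -- `Φ'`, the derivative of `Φ` on `(0, ∞)`
    (DPhi : ℝ → ℝ)
    (hDPhi : ∀ y : ℝ, 0 < y → HasDerivAt (fun t : ℝ => (Phi t).toReal) (DPhi y) y)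
    (lam : ℝ) (hlam : 0 < lam)
    -- `N` is a convex set of pairs `(η, s)` with `η ∈ L_Φ`, `E[η] > 0` and `s ∈ [0, ∞)`
    (N : Set ((Ω → ℝ) × ℝ))
    (hN_conv : Convex ℝ N)
    (hN : ∀ p ∈ N, Measurable p.1 ∧ (∀ ω, 0 ≤ p.1 ω) ∧
      (∫⁻ ω, (Phi (p.1 ω)).toENN ∂P < ⊤) ∧
      (0 < ∫⁻ ω, ENNReal.ofReal (p.1 ω) ∂P) ∧ 0 ≤ p.2)
    -- `(η*, s*) ∈ N` minimizes `(η, s) ↦ E[Φ(λη)] + λs` over `N`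
    (etaS : Ω → ℝ) (sS : ℝ) (hmem : (etaS, sS) ∈ N)
    (hmin : ∀ p ∈ N,
      ewp P (fun ω => Phi (lam * etaS ω)) + ((lam * sS : ℝ) : EReal) ≤
        ewp P (fun ω => Phi (lam * p.1 ω)) + ((lam * p.2 : ℝ) : EReal)) :
    -- `η*·Φ'(λη*) ∈ L¹(P)`
    Integrable (fun ω => if etaS ω = 0 then 0 else etaS ω * DPhi (lam * etaS ω)) P ∧
    ∀ p ∈ N,
      -- `(η·Φ'(λη*))⁺ ∈ L¹(P)`
      Integrable (fun ω => if etaS ω = 0 then 0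
        else max (p.1 ω * DPhi (lam * etaS ω)) 0) P ∧
      -- `E[η·(-Φ'(λη*))] - s ≤ E[η*·(-Φ'(λη*))] - s*` in the extended reals,
      -- where `η·(-Φ'(λη*)) = +∞` on `{η* = 0, η > 0}` since `Φ'(0⁺) = -∞`
      ewp P (fun ω => if etaS ω = 0 then (if p.1 ω = 0 then 0 else ⊤)
          else ((p.1 ω * (-(DPhi (lam * etaS ω))) : ℝ) : EReal)) - ((p.2 : ℝ) : EReal) ≤
        ewp P (fun ω => if etaS ω = 0 then 0
          else ((etaS ω * (-(DPhi (lam * etaS ω))) : ℝ) : EReal)) - ((sS : ℝ) : EReal) := by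
  obtain ⟨hnb, hlow, hfin, hconv, h0⟩ := s8_phi a ha u hu_ne_top hu_bot hu_fin hu_mono du hdu
    hdu_pos hdu_anti hdu_inada_top hdu_inada_zero Phi hPhi
  have hint : ∀ p ∈ N, ∀ l : ℝ, 0 < l → (∀ᵐ ω ∂P, Phi (l * p.1 ω) ≠ ⊤) ∧
      Integrable (fun ω => (Phi (l * p.1 ω)).toReal) P := by
    intro p hp l hl
    obtain ⟨h1, h2, h3, -, -⟩ := hN p hp
    exact s8_int P Phi _ hnb hlow hfin DPhi hDPhi (h1.const_mul l)
      (fun ω => mul_nonneg hl.le (h2 ω)) (hA2 p.1 h1 h2 h3 l hl)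
  have hewp : ∀ p ∈ N, ewp P (fun ω => Phi (lam * p.1 ω)) =
      ((∫ ω, (Phi (lam * p.1 ω)).toReal ∂P : ℝ) : EReal) := by
    intro p hp
    obtain ⟨h1, h2⟩ := hint p hp lam hlam
    refine s8_ewp P _ _ h2 ?_
    filter_upwards [h1] with ω hω
    exact (EReal.coe_toReal hω (hnb _)).symm
  obtain ⟨he, he0, -, -, -⟩ := hN _ hmem
  have hA := s8_intA P hconv hfin DPhi hDPhi lam hlam he he0 (fun l hl => (hint _ hmem l hl).2)
  refine ⟨hA, fun p hp => ?_⟩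
  obtain ⟨hh, hh0, -, -, -⟩ := hN p hp
  have hpt : ∀ t : ℝ, 0 < t → t ≤ 1 →
      ((fun ω => etaS ω + t * (p.1 ω - etaS ω), sS + t * (p.2 - sS)) : (Ω → ℝ) × ℝ) ∈ N := by
    intro t ht ht1
    have := hN_conv hmem hp (sub_nonneg.2 ht1) ht.le (by ring)
    convert this using 1
    ext
    · simp; ring
    · simp; ring
  obtain ⟨hz, hWI, hW⟩ := s8_fatou P hconv hfin DPhi hDPhi h0 lam hlam p.2 sS he he0 hh hh0
    (hint _ hmem lam hlam).1 (hint p hp lam hlam).1 (hint _ hmem lam hlam).2 (hint p hp lam hlam).2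
    (fun t ht ht1 => (hint _ (hpt t ht ht1) lam hlam).2)
    (fun t ht ht1 => by
      have h1 := hmin _ (hpt t ht ht1)
      rw [hewp _ (hpt t ht ht1), hewp _ hmem, ← EReal.coe_add, ← EReal.coe_add,
        EReal.coe_le_coe_iff] at h1
      exact h1)
  have hBI : Integrable (fun ω => if etaS ω = 0 then 0 else p.1 ω * DPhi (lam * etaS ω)) P := by
    refine (hWI.add hA).congr (ae_of_all _ fun ω => ?_)
    simp only [Pi.add_apply]
    split_ifs
    · simp
    · ring
  have hBe : ∫ ω, (if etaS ω = 0 then 0 else p.1 ω * DPhi (lam * etaS ω)) ∂P =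
      ∫ ω, (if etaS ω = 0 then 0 else (p.1 ω - etaS ω) * DPhi (lam * etaS ω)) ∂P +
      ∫ ω, (if etaS ω = 0 then 0 else etaS ω * DPhi (lam * etaS ω)) ∂P := by
    rw [← integral_add hWI hA]
    refine integral_congr_ae (ae_of_all _ fun ω => ?_)
    simp only
    split_ifs
    · simp
    · ring
  refine ⟨?_, ?_⟩
  · refine hBI.pos_part.congr (ae_of_all _ fun ω => ?_)
    simp only
    split_ifs
    · simp
    · rfl
  · rw [s8_ewp P _ _ hBI.neg, s8_ewp P _ _ hA.neg, ← EReal.coe_sub, ← EReal.coe_sub,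
      EReal.coe_le_coe_iff]
    · simp only [Pi.neg_apply, integral_neg]
      linarith
    · refine ae_of_all _ fun ω => ?_
      simp only [Pi.neg_apply]
      split_ifs
      · simp
      · rw [mul_neg]
    · filter_upwards [hz] with ω hω
      simp only [Pi.neg_apply]
      split_ifs with h1 h2
      · simp
      · exact absurd (hω h1) h2
      · rw [mul_neg]

end
end

section
/- Assume (A1) and (A2). Let η ∈ L⁰(P) with η ≥ 0, E[Φ(η)] < ∞ and 0 < E[η] ≤ 1, let c ∈ ℝ with c > a·E[η], and let λ* > 0 be the unique minimizer of λ ↦ λc + E[Φ(λη)] over (0, ∞). Define f* := -Φ'(λ*η) on {η > 0} and f* := +∞ on {η = 0}, interpreting u(+∞) := lim_{x→∞} u(x) = Φ(0⁺) (note P(η = 0) > 0 forces Φ(0) < ∞, since E[Φ(η)] < ∞). Then ∫ η f* dP = c (in particular f* ∈ L¹(η dP)), u(f*) ∈ L¹(P), and λ*c + E[Φ(λ*η)] = E[u(f*)] = sup{ E[u(f)] : f measurable, ∫ η|f| dP < ∞, ∫ η f dP ≤ c, and E[u(f)] well defined } < u(+∞). -/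
open MeasureTheory Filter Set Topology
open scoped ENNReal

noncomputable section

theorem toENN_coe' (x : ℝ) : (x : EReal).toENN = ENNReal.ofReal x := by
  simp [EReal.toENN]

theorem toENN_neg_coe' (x : ℝ) : (-(x : EReal)).toENN = ENNReal.ofReal (-x) := by
  rw [← EReal.coe_neg, toENN_coe']

theorem ewp_eq_integral' {Ω : Type*} [MeasurableSpace Ω] (P : Measure Ω) (H : Ω → EReal)
    (h : Ω → ℝ) (hi : Integrable h P) (hH : ∀ᵐ ω ∂P, H ω = (h ω : EReal)) :
    ewp P H = ((∫ ω, h ω ∂P : ℝ) : EReal) := by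
  have h1 : ∫⁻ ω, (H ω).toENN ∂P = ∫⁻ ω, ENNReal.ofReal (h ω) ∂P := by
    apply lintegral_congr_ae
    filter_upwards [hH] with ω hω
    rw [hω, toENN_coe']
  have h2 : ∫⁻ ω, (-(H ω)).toENN ∂P = ∫⁻ ω, ENNReal.ofReal (-(h ω)) ∂P := by
    apply lintegral_congr_ae
    filter_upwards [hH] with ω hω
    rw [hω, toENN_neg_coe']
  have f1 : ∫⁻ ω, ENNReal.ofReal (h ω) ∂P ≠ ⊤ := hi.lintegral_lt_top.ne
  have f2 : ∫⁻ ω, ENNReal.ofReal (-(h ω)) ∂P ≠ ⊤ := hi.neg.lintegral_lt_top.ne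
  unfold ewp
  rw [h1, h2, integral_eq_lintegral_pos_part_sub_lintegral_neg_part hi, EReal.coe_sub,
    EReal.coe_ennreal_toReal f1, EReal.coe_ennreal_toReal f2]

theorem ewp_le_integral' {Ω : Type*} [MeasurableSpace Ω] (P : Measure Ω) (H : Ω → EReal)
    (h : Ω → ℝ) (hi : Integrable h P) (hH : ∀ᵐ ω ∂P, H ω ≤ (h ω : EReal)) :
    ewp P H ≤ ((∫ ω, h ω ∂P : ℝ) : EReal) := by
  have hA : ∫⁻ ω, (H ω).toENN ∂P ≤ ∫⁻ ω, ENNReal.ofReal (h ω) ∂P := by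
    apply lintegral_mono_ae
    filter_upwards [hH] with ω hω
    induction hx : H ω using EReal.rec with
    | bot => simp [EReal.toENN]
    | coe x =>
      rw [toENN_coe']
      rw [hx] at hω
      exact ENNReal.ofReal_le_ofReal (EReal.coe_le_coe_iff.1 hω)
    | top => rw [hx] at hω; simp at hω
  have hB : ∫⁻ ω, ENNReal.ofReal (-(h ω)) ∂P ≤ ∫⁻ ω, (-(H ω)).toENN ∂P := by
    apply lintegral_mono_ae
    filter_upwards [hH] with ω hω
    induction hx : H ω using EReal.rec with
    | bot => simp [EReal.toENN]
    | coe x =>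
      rw [toENN_neg_coe']
      rw [hx] at hω
      exact ENNReal.ofReal_le_ofReal (neg_le_neg (EReal.coe_le_coe_iff.1 hω))
    | top => rw [hx] at hω; simp at hω
  rw [← ewp_eq_integral' P (fun ω => (h ω : EReal)) h hi (by simp)]
  unfold ewp
  simp only [toENN_coe', toENN_neg_coe']
  apply EReal.sub_le_sub
  · exact_mod_cast hA
  · exact_mod_cast hB

/-- Young-type inequality: for each `y > 0` there is a maximizer `x = I(y)`. -/
theorem exists_maximizer'
    (a : EReal) (u : ℝ → EReal)
    (hu_ne_top : ∀ x : ℝ, u x ≠ ⊤)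
    (hu_bot : ∀ x : ℝ, (x : EReal) < a → u x = ⊥)
    (hu_mono : Monotone u)
    (du : ℝ → ℝ)
    (hdu : ∀ x : ℝ, a < (x : EReal) → HasDerivAt (fun t : ℝ => (u t).toReal) (du x) x)
    (hdu_cont : ContinuousOn du {x : ℝ | a < (x : EReal)})
    (hdu_anti : StrictAntiOn du {x : ℝ | a < (x : EReal)})
    (hdu_inada_top : ∀ M : ℝ, ∃ x : ℝ, a < (x : EReal) ∧ M ≤ du x)
    (hdu_inada_zero : Tendsto du atTop (𝓝 0)) (y : ℝ) (hy : 0 < y) :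
    ∃ x : ℝ, a < (x : EReal) ∧ ∀ z : ℝ, u z ≤ (((u x).toReal + y * (z - x) : ℝ) : EReal) := by
  obtain ⟨x1, hx1, hM⟩ := hdu_inada_top y
  obtain ⟨x2, hx2, hx12⟩ :=
    ((hdu_inada_zero.eventually (gt_mem_nhds hy)).and (eventually_ge_atTop x1)).exists
  have up : ∀ z w : ℝ, a < (z : EReal) → z ≤ w → a < (w : EReal) := fun z w h1 h2 =>
    lt_of_lt_of_le h1 (EReal.coe_le_coe_iff.2 h2)
  have hsub : Icc x1 x2 ⊆ {x : ℝ | a < (x : EReal)} := fun z hz => up x1 z hx1 hz.1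
  obtain ⟨x, hx, hxy⟩ := intermediate_value_Icc' hx12 (hdu_cont.mono hsub) ⟨hx2.le, hM⟩
  have hax : a < (x : EReal) := hsub hx
  refine ⟨x, hax, ?_⟩
  have key : ∀ z : ℝ, a < (z : EReal) → (u z).toReal ≤ (u x).toReal + y * (z - x) := by
    intro z hz
    rcases lt_trichotomy z x with h | h | h
    · obtain ⟨w, hw, he⟩ := exists_hasDerivAt_eq_slope (fun t : ℝ => (u t).toReal) du h
        (fun t ht => (hdu t (up z t hz ht.1)).continuousAt.continuousWithinAt)
        (fun t ht => hdu t (up z t hz ht.1.le))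
      have : du x < du w := hdu_anti (up z w hz hw.1.le) hax hw.2
      rw [eq_div_iff (by linarith)] at he
      nlinarith
    · subst h; simp
    · obtain ⟨w, hw, he⟩ := exists_hasDerivAt_eq_slope (fun t : ℝ => (u t).toReal) du h
        (fun t ht => (hdu t (up x t hax ht.1)).continuousAt.continuousWithinAt)
        (fun t ht => hdu t (up x t hax ht.1.le))
      have : du w < du x := hdu_anti hax (up x w hax hw.1.le) hw.1
      rw [eq_div_iff (by linarith)] at he
      nlinarith
  intro z
  by_cases hz : u z = ⊥
  · simp [hz]
  have haz : a ≤ (z : EReal) := by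
    by_contra h
    exact hz (hu_bot z (not_le.1 h))
  rw [← EReal.coe_toReal (hu_ne_top z) hz, EReal.coe_le_coe_iff]
  apply le_of_forall_pos_le_add
  intro e he
  have hlt : a < ((z + e / y : ℝ) : EReal) :=
    lt_of_le_of_lt haz (EReal.coe_lt_coe_iff.2 (by have := div_pos he hy; linarith))
  have h1 := key _ hlt
  have h2 : (u z).toReal ≤ (u (z + e / y)).toReal :=
    EReal.toReal_le_toReal (hu_mono (by have := div_pos he hy; linarith)) hz (hu_ne_top _)
  have : y * (z + e / y - x) = y * (z - x) + e := by field_simp; ring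
  linarith

/-- Proposition 26, second part.  Assume (A1), (A2).  Let `η ≥ 0` with
`E[Φ(η)] < ∞`, `0 < E[η] ≤ 1`, `c > a·E[η]`, and let `λ* > 0` minimize
`λ ↦ λc + E[Φ(λη)]` over `(0, ∞)`.  Define `f* := -Φ'(λ*η)` on `{η > 0}` and `f* := +∞`
on `{η = 0}`, with `u(+∞) := lim_{x→∞} u(x)`.  Then `∫ η f* dP = c`, `u(f*) ∈ L¹(P)` and
`λ*c + E[Φ(λ*η)] = E[u(f*)] = sup{E[u(f)] : ∫η|f| < ∞, ∫ηf ≤ c, E[u(f)] well defined}`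
`< u(+∞)`. -/
theorem statement10
    {Ω : Type*} [MeasurableSpace Ω] (P : Measure Ω) [IsProbabilityMeasure P]
    (a : EReal) (ha : a < 0)
    (u : ℝ → EReal)
    (hu_ne_top : ∀ x : ℝ, u x ≠ ⊤)
    (hu_bot : ∀ x : ℝ, (x : EReal) < a → u x = ⊥)
    (hu_fin : ∀ x : ℝ, a < (x : EReal) → u x ≠ ⊥)
    (hu_mono : Monotone u)
    (hu_lim : Tendsto u atBot (𝓝 ⊥))
    (du : ℝ → ℝ)
    (hdu : ∀ x : ℝ, a < (x : EReal) → HasDerivAt (fun t : ℝ => (u t).toReal) (du x) x)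
    (hdu_cont : ContinuousOn du {x : ℝ | a < (x : EReal)})
    (hdu_pos : ∀ x : ℝ, a < (x : EReal) → 0 < du x)
    (hdu_anti : StrictAntiOn du {x : ℝ | a < (x : EReal)})
    (hdu_inada_top : ∀ M : ℝ, ∃ x : ℝ, a < (x : EReal) ∧ M ≤ du x)
    (hdu_inada_zero : Tendsto du atTop (𝓝 0))
    (Phi : ℝ → EReal)
    (hPhi : ∀ y : ℝ, Phi y = ⨆ x : ℝ, (u x - ((x * y : ℝ) : EReal)))
    (hA2 : ∀ g : Ω → ℝ, Measurable g → (∀ ω, 0 ≤ g ω) →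
      ∫⁻ ω, (Phi (g ω)).toENN ∂P < ⊤ →
      ∀ l : ℝ, 0 < l → ∫⁻ ω, (Phi (l * g ω)).toENN ∂P < ⊤)
    (DPhi : ℝ → ℝ)
    (hDPhi : ∀ y : ℝ, 0 < y → HasDerivAt (fun t : ℝ => (Phi t).toReal) (DPhi y) y)
    -- `u(+∞) := lim_{x→∞} u(x)`
    (uSup : EReal) (huSup : uSup = ⨆ x : ℝ, u x)
    -- `η ∈ L_Φ` with `0 < E[η] ≤ 1`
    (eta : Ω → ℝ) (heta_meas : Measurable eta) (heta_nonneg : ∀ ω, 0 ≤ eta ω)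
    (hetaPhi : ∫⁻ ω, (Phi (eta ω)).toENN ∂P < ⊤)
    (hmean_pos : 0 < ∫⁻ ω, ENNReal.ofReal (eta ω) ∂P)
    (hmean_le : ∫⁻ ω, ENNReal.ofReal (eta ω) ∂P ≤ 1)
    -- `c > a·E[η]`
    (c : ℝ) (hc : a * ((∫⁻ ω, ENNReal.ofReal (eta ω) ∂P : ℝ≥0∞) : EReal) < (c : EReal))
    -- `λ* > 0` is the minimizer of `λ ↦ λc + E[Φ(λη)]` over `(0, ∞)`
    (lam : ℝ) (hlam : 0 < lam)
    (hmin : ∀ t : ℝ, 0 < t →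
      ((lam * c : ℝ) : EReal) + ewp P (fun ω => Phi (lam * eta ω)) ≤
        ((t * c : ℝ) : EReal) + ewp P (fun ω => Phi (t * eta ω))) :
    -- `∫ η f* dP = c`  (on `{η = 0}` the integrand `η·f*` vanishes)
    Integrable (fun ω => if eta ω = 0 then 0 else eta ω * (-(DPhi (lam * eta ω)))) P ∧
    (∫ ω, (if eta ω = 0 then 0 else eta ω * (-(DPhi (lam * eta ω)))) ∂P) = c ∧
    -- `u(f*) ∈ L¹(P)` and the value identities hold
    ∃ g : Ω → ℝ, Integrable g P ∧
      (∀ᵐ ω ∂P, ((g ω : ℝ) : EReal) =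
        if eta ω = 0 then uSup else u (-(DPhi (lam * eta ω)))) ∧
      ((lam * c : ℝ) : EReal) + ewp P (fun ω => Phi (lam * eta ω)) =
        ((∫ ω, g ω ∂P : ℝ) : EReal) ∧
      IsLUB {r : EReal | ∃ f : Ω → ℝ, Measurable f ∧
          Integrable (fun ω => eta ω * |f ω|) P ∧
          (∫ ω, eta ω * f ω ∂P) ≤ c ∧
          ((∫⁻ ω, (u (f ω)).toENN ∂P ≠ ⊤) ∨ (∫⁻ ω, (-(u (f ω))).toENN ∂P ≠ ⊤)) ∧
          r = ewp P (fun ω => u (f ω))}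
        ((∫ ω, g ω ∂P : ℝ) : EReal) ∧
      ((∫ ω, g ω ∂P : ℝ) : EReal) < uSup := by
  set U : ℝ → ℝ := fun t => (u t).toReal with hU
  set φ : ℝ → ℝ := fun t => (Phi t).toReal with hφ
  have coeU : ∀ x : ℝ, a < (x : EReal) → u x = (U x : EReal) := fun x hx =>
    (EReal.coe_toReal (hu_ne_top x) (hu_fin x hx)).symm
  have ha0 : a < ((0 : ℝ) : EReal) := by simpa using ha
  have Phi_ge : ∀ y z : ℝ, u z - ((z * y : ℝ) : EReal) ≤ Phi y := fun y z => by
    rw [hPhi y]; exact le_iSup (fun x : ℝ => u x - ((x * y : ℝ) : EReal)) z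
  have Phi0 : Phi 0 = uSup := by rw [hPhi, huSup]; simp
  have Phi_lb : ∀ y, ((U 0 : ℝ) : EReal) ≤ Phi y := fun y => by
    have := Phi_ge y 0
    rw [coeU 0 ha0] at this
    simpa using this
  -- the maximizer
  have hmax : ∀ y : ℝ, 0 < y → a < ((-(DPhi y) : ℝ) : EReal) ∧
      Phi y = (φ y : EReal) ∧ u (-(DPhi y)) = ((φ y - y * DPhi y : ℝ) : EReal) ∧
      ∀ s, 0 < s → φ y + DPhi y * (s - y) ≤ φ s := by
    have pre : ∀ y : ℝ, 0 < y → ∃ x : ℝ, a < (x : EReal) ∧ Phi y = ((U x - x * y : ℝ) : EReal) := by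
      intro y hy
      obtain ⟨x, hax, hx⟩ := exists_maximizer' a u hu_ne_top hu_bot hu_mono du hdu hdu_cont
        hdu_anti hdu_inada_top hdu_inada_zero y hy
      refine ⟨x, hax, le_antisymm ?_ ?_⟩
      · rw [hPhi]
        apply iSup_le
        intro z
        rw [EReal.sub_le_iff_le_add (Or.inl (EReal.coe_ne_bot _)) (Or.inl (EReal.coe_ne_top _)),
          ← EReal.coe_add]
        refine (hx z).trans (EReal.coe_le_coe_iff.2 ?_)
        simp only [hU]; nlinarith
      · have := Phi_ge y x
        rwa [coeU x hax, ← EReal.coe_sub] at this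
    have coeφ : ∀ y : ℝ, 0 < y → Phi y = (φ y : EReal) := by
      intro y hy
      obtain ⟨x, -, hx⟩ := pre y hy
      simp only [hφ, hx, EReal.toReal_coe]
    intro y hy
    obtain ⟨x, hax, hx⟩ := pre y hy
    have hφy : φ y = U x - x * y := by simp only [hφ, hx, EReal.toReal_coe]
    have hsub : ∀ s, 0 < s → U x - x * s ≤ φ s := by
      intro s hs
      have := Phi_ge s x
      rwa [coeU x hax, ← EReal.coe_sub, coeφ s hs, EReal.coe_le_coe_iff] at this
    have hD : DPhi y = -x := by
      have hd : HasDerivAt (fun t => φ t + x * t) (DPhi y + x * 1) y :=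
        (hDPhi y hy).add ((hasDerivAt_id y).const_mul x)
      have hloc : IsLocalMin (fun t => φ t + x * t) y := by
        filter_upwards [lt_mem_nhds hy] with t ht
        have := hsub t ht
        linarith
      have := hloc.hasDerivAt_eq_zero hd
      linarith
    rw [hD, neg_neg]
    refine ⟨hax, coeφ y hy, ?_, ?_⟩
    · rw [coeU x hax, hφy]; congr 1; ring
    · intro s hs; have := hsub s hs; rw [hφy]; linarith
  have φ_lb : ∀ y, 0 < y → U 0 ≤ φ y := fun y hy => by
    have := Phi_lb y
    rwa [(hmax y hy).2.1, EReal.coe_le_coe_iff] at this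
  have hlt : ∀ y, 0 < y → u (-(DPhi y)) < uSup := by
    intro y hy
    have hax := (hmax y hy).1
    set x := -(DPhi y)
    have hx1 : a < ((x + 1 : ℝ) : EReal) :=
      hax.trans (EReal.coe_lt_coe_iff.2 (by linarith))
    have : U x < U (x + 1) := by
      obtain ⟨w, hw, he⟩ := exists_hasDerivAt_eq_slope U du (show x < x + 1 by linarith)
        (fun t ht => (hdu t (hax.trans_le (EReal.coe_le_coe_iff.2 ht.1))).continuousAt.continuousWithinAt)
        (fun t ht => hdu t (hax.trans (EReal.coe_lt_coe_iff.2 ht.1)))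
      have := hdu_pos w (hax.trans (EReal.coe_lt_coe_iff.2 hw.1))
      rw [he] at this
      simp at this
      exact this
    calc u x = (U x : EReal) := coeU x hax
      _ < (U (x + 1) : EReal) := EReal.coe_lt_coe_iff.2 this
      _ = u (x + 1) := (coeU _ hx1).symm
      _ ≤ uSup := by rw [huSup]; exact le_iSup u (x + 1)
  have u_le_sup : ∀ x, u x ≤ uSup := fun x => by rw [huSup]; exact le_iSup u x
  -- η = 0 is negligible if `uSup = ⊤`
  have hz_meas : MeasurableSet {ω | eta ω = 0} := heta_meas (measurableSet_singleton 0)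
  have hae0 : ∀ᵐ ω ∂P, eta ω = 0 → uSup ≠ ⊤ := by
    by_cases ht : uSup = ⊤
    · have h1 : ∫⁻ ω, ({ω | eta ω = 0}.indicator (fun _ => (⊤ : ℝ≥0∞))) ω ∂P ≤
          ∫⁻ ω, (Phi (eta ω)).toENN ∂P := by
        apply lintegral_mono
        intro ω
        by_cases h : eta ω = 0
        · simp [h, Phi0, ht, EReal.toENN]
        · simp [h]
      rw [lintegral_indicator_const hz_meas] at h1
      have h2 : P {ω | eta ω = 0} = 0 := by
        by_contra hne
        rw [ENNReal.top_mul hne] at h1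
        exact absurd hetaPhi (not_lt.2 h1)
      have h3 : ∀ᵐ ω ∂P, ¬ (eta ω = 0) := by
        rw [ae_iff]; simpa using h2
      filter_upwards [h3] with ω hω h
      exact absurd h hω
    · exact Eventually.of_forall fun ω _ => ht
  have uSup_ne_bot : uSup ≠ ⊥ := by
    have h := u_le_sup 0
    rw [coeU 0 ha0] at h
    exact ne_bot_of_le_ne_bot (EReal.coe_ne_bot _) h
  have hpos : ∀ ω, eta ω ≠ 0 → 0 < eta ω := fun ω h => lt_of_le_of_ne (heta_nonneg ω) (Ne.symm h)
  have φ0 : uSup ≠ ⊤ → uSup = (φ 0 : EReal) := fun h => by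
    simp only [hφ, Phi0]; exact (EReal.coe_toReal h uSup_ne_bot).symm
  have hcoe : ∀ᵐ ω ∂P, ∀ l : ℝ, 0 < l → Phi (l * eta ω) = (φ (l * eta ω) : EReal) := by
    filter_upwards [hae0] with ω hω l hl
    by_cases h : eta ω = 0
    · rw [h, mul_zero, Phi0]; exact φ0 (hω h)
    · exact (hmax _ (mul_pos hl (hpos ω h))).2.1
  have hφlb : ∀ᵐ ω ∂P, ∀ l : ℝ, 0 < l → U 0 ≤ φ (l * eta ω) := by
    filter_upwards [hcoe] with ω hω l hl
    have := Phi_lb (l * eta ω)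
    rwa [hω l hl, EReal.coe_le_coe_iff] at this
  -- measurability
  have hφmeas : ∀ l : ℝ, 0 < l → Measurable (fun ω => φ (l * eta ω)) := by
    intro l hl
    have hc1 : ContinuousOn φ (Ioi 0) := fun y hy =>
      (hDPhi y hy).continuousAt.continuousWithinAt
    have hm : Measurable (fun y : ℝ => if y ∈ Ioi (0 : ℝ) then φ y else φ 0) := by
      classical
      have := hc1.measurable_piecewise (g := fun _ => φ 0) continuousOn_const measurableSet_Ioi
      convert this using 1
      ext y
      by_cases h : y ∈ Ioi (0 : ℝ) <;> simp [Set.piecewise, h]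
    have := hm.comp (heta_meas.const_mul l)
    convert this using 1
    ext ω
    by_cases h : eta ω = 0
    · simp [h]
    · simp [mul_pos hl (hpos ω h)]
  have hDmeas : ∀ l : ℝ, 0 < l → ∀ r : ℝ, Measurable (fun ω => if eta ω = 0 then r else -(DPhi (l * eta ω))) := by
    intro l hl r
    have hm : Measurable (fun ω => if eta ω = 0 then r else -(deriv φ (l * eta ω))) :=
      Measurable.ite hz_meas measurable_const ((measurable_deriv φ).comp (heta_meas.const_mul l)).neg
    convert hm using 1
    ext ω
    by_cases h : eta ω = 0
    · simp [h]
    · simp only [h, if_false]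
      rw [(hDPhi _ (mul_pos hl (hpos ω h))).deriv]
  -- integrability of φ(lη)
  have hφint : ∀ l : ℝ, 0 < l → Integrable (fun ω => φ (l * eta ω)) P := by
    intro l hl
    have hfin := hA2 eta heta_meas heta_nonneg hetaPhi l hl
    have h1 : ∫⁻ ω, ENNReal.ofReal (φ (l * eta ω)) ∂P < ⊤ := by
      refine lt_of_le_of_lt (le_of_eq ?_) hfin
      apply lintegral_congr_ae
      filter_upwards [hcoe] with ω hω
      rw [hω l hl, toENN_coe']
    have h2 : Integrable (fun ω => max (φ (l * eta ω)) 0) P := by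
      refine ⟨((hφmeas l hl).max measurable_const).aestronglyMeasurable, ?_⟩
      have hnn : (0 : Ω → ℝ) ≤ᵐ[P] fun ω => max (φ (l * eta ω)) 0 :=
        Eventually.of_forall fun ω => le_max_right _ _
      rw [hasFiniteIntegral_iff_ofReal hnn]
      refine lt_of_le_of_lt (le_of_eq ?_) h1
      apply lintegral_congr
      intro ω
      simp [ENNReal.ofReal_max]
    refine (h2.add (integrable_const |U 0|)).mono' (hφmeas l hl).aestronglyMeasurable ?_
    filter_upwards [hφlb] with ω hω
    have h3 := hω l hl
    simp only [Pi.add_apply, Real.norm_eq_abs]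
    rw [abs_le]
    constructor
    · have := le_max_right (φ (l * eta ω)) 0
      have := neg_abs_le (U 0)
      linarith
    · have := le_max_left (φ (l * eta ω)) 0
      have := abs_nonneg (U 0)
      linarith
  have hewp : ∀ l : ℝ, 0 < l → ewp P (fun ω => Phi (l * eta ω)) =
      ((∫ ω, φ (l * eta ω) ∂P : ℝ) : EReal) := fun l hl =>
    ewp_eq_integral' P _ _ (hφint l hl) (hcoe.mono fun ω hω => hω l hl)
  -- derivative under the integral
  set F' : ℝ → Ω → ℝ := fun t ω => if eta ω = 0 then 0 else eta ω * DPhi (t * eta ω) with hF'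
  have hF'meas : Measurable (F' lam) := by
    have : Measurable (fun ω => eta ω * -(if eta ω = 0 then 0 else -(DPhi (lam * eta ω)))) :=
      heta_meas.mul (hDmeas lam hlam 0).neg
    convert this using 1
    ext ω
    by_cases h : eta ω = 0 <;> simp [hF', h]
  have hder := hasDerivAt_integral_of_dominated_loc_of_deriv_le (μ := P)
    (F := fun t ω => φ (t * eta ω)) (F' := F') (x₀ := lam) (s := Ioo (lam / 2) (3 * lam / 2))
    (bound := fun ω => (|φ (2 * lam * eta ω)| + |φ (lam / 4 * eta ω)| + 2 * |U 0|) * (4 / lam))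
    (Ioo_mem_nhds (by linarith) (by linarith))
    (by
      filter_upwards [lt_mem_nhds hlam] with t ht
      exact (hφmeas t ht).aestronglyMeasurable)
    (hφint lam hlam) hF'meas.aestronglyMeasurable
    (by
      refine Eventually.of_forall fun ω t ht => ?_
      by_cases h : eta ω = 0
      · simp only [hF', h, if_true, norm_zero]; positivity
      simp only [hF', h, if_false]
      have he := hpos ω h
      have ht0 : 0 < t := by linarith [ht.1]
      have hty := mul_pos ht0 he
      have h1 := (hmax _ hty).2.2.2 (2 * lam * eta ω) (by positivity)
      have h2 := (hmax _ hty).2.2.2 (lam / 4 * eta ω) (by positivity)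
      have h3 := φ_lb _ hty
      have h4 := neg_abs_le (U 0)
      have h5 := le_abs_self (φ (2 * lam * eta ω))
      have h6 := le_abs_self (φ (lam / 4 * eta ω))
      have h7 := abs_nonneg (φ (2 * lam * eta ω))
      have h8 := abs_nonneg (φ (lam / 4 * eta ω))
      have h9 := abs_nonneg (U 0)
      set K := |φ (2 * lam * eta ω)| + |φ (lam / 4 * eta ω)| + 2 * |U 0| with hK
      set d := eta ω * DPhi (t * eta ω) with hd
      have e1 : d * (2 * lam - t) ≤ K := by
        have : d * (2 * lam - t) = DPhi (t * eta ω) * (2 * lam * eta ω - t * eta ω) := by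
          rw [hd]; ring
        linarith
      have e2 : (-d) * (t - lam / 4) ≤ K := by
        have : (-d) * (t - lam / 4) = DPhi (t * eta ω) * (lam / 4 * eta ω - t * eta ω) := by
          rw [hd]; ring
        linarith
      have hK0 : 0 ≤ K := by positivity
      rw [Real.norm_eq_abs, mul_div_assoc', le_div_iff₀ hlam]
      rcases abs_cases d with ⟨hab, hs⟩ | ⟨hab, hs⟩
      · rw [hab]; nlinarith [ht.1, ht.2]
      · rw [hab]; nlinarith [ht.1, ht.2])
    (by
      have i1 := (hφint (2 * lam) (by positivity)).abs
      have i2 := (hφint (lam / 4) (by positivity)).abs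
      exact ((i1.add i2).add (integrable_const _)).mul_const _)
    (by
      refine Eventually.of_forall fun ω t ht => ?_
      by_cases h : eta ω = 0
      · simp only [hF', h, if_true, mul_zero]; exact hasDerivAt_const _ _
      simp only [hF', h, if_false]
      have ht0 : 0 < t := by linarith [ht.1]
      have hm1 : HasDerivAt (fun s : ℝ => s * eta ω) (eta ω) t := by
        simpa using (hasDerivAt_id t).mul_const (eta ω)
      have := (hDPhi (t * eta ω) (mul_pos ht0 (hpos ω h))).comp t hm1
      rw [mul_comm (eta ω)]
      exact this)
  obtain ⟨hF'int, hFder⟩ := hder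
  have hzero : c + ∫ ω, F' lam ω ∂P = 0 := by
    have hd : HasDerivAt (fun t => t * c + ∫ ω, φ (t * eta ω) ∂P)
        (1 * c + ∫ ω, F' lam ω ∂P) lam :=
      ((hasDerivAt_id lam).mul_const c).add hFder
    have hloc : IsLocalMin (fun t => t * c + ∫ ω, φ (t * eta ω) ∂P) lam := by
      filter_upwards [lt_mem_nhds hlam] with t ht
      have := hmin t ht
      rwa [hewp t ht, hewp lam hlam, ← EReal.coe_add, ← EReal.coe_add, EReal.coe_le_coe_iff] at this
    have := hloc.hasDerivAt_eq_zero hd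
    linarith
  have hfneg : (fun ω => if eta ω = 0 then 0 else eta ω * (-(DPhi (lam * eta ω)))) =
      fun ω => -(F' lam ω) := by
    ext ω
    by_cases h : eta ω = 0 <;> simp [hF', h]
  rw [hfneg]
  have hIc : ∫ ω, -(F' lam ω) ∂P = c := by rw [integral_neg]; linarith
  have hnF : Integrable (fun ω => -(F' lam ω)) P := hF'int.neg
  set g : Ω → ℝ := fun ω => φ (lam * eta ω) + lam * (-(F' lam ω)) with hg
  have hgint : Integrable g P := (hφint lam hlam).add (hnF.const_mul lam)
  have hgI : ∫ ω, g ω ∂P = (∫ ω, φ (lam * eta ω) ∂P) + lam * c := by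
    rw [hg, integral_add (hφint lam hlam) (hnF.const_mul lam), integral_const_mul, hIc]
  have hgae : ∀ᵐ ω ∂P, ((g ω : ℝ) : EReal) =
        if eta ω = 0 then uSup else u (-(DPhi (lam * eta ω))) := by
    filter_upwards [hae0] with ω hω
    by_cases h : eta ω = 0
    · simp only [hg, hF', h, if_true, mul_zero, neg_zero, add_zero]
      exact (φ0 (hω h)).symm
    · simp only [hg, hF', h, if_false]
      rw [(hmax _ (mul_pos hlam (hpos ω h))).2.2.1]
      congr 1; ring
  refine ⟨hnF, hIc, g, hgint, hgae, ?_, ⟨?_, ?_⟩, ?_⟩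
  · rw [hewp lam hlam, ← EReal.coe_add, hgI, add_comm]
  · rintro r ⟨f, hfm, hfi, hfc, -, rfl⟩
    have hfi' : Integrable (fun ω => eta ω * f ω) P := by
      refine hfi.mono' (heta_meas.mul hfm).aestronglyMeasurable (Eventually.of_forall fun ω => ?_)
      rw [Real.norm_eq_abs, abs_mul, abs_of_nonneg (heta_nonneg ω)]
    refine (ewp_le_integral' P (fun ω => u (f ω))
      (fun ω => φ (lam * eta ω) + lam * (eta ω * f ω))
      ((hφint lam hlam).add (hfi'.const_mul lam)) ?_).trans ?_
    · filter_upwards [hcoe] with ω hω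
      have h1 := Phi_ge (lam * eta ω) (f ω)
      rw [hω lam hlam, EReal.sub_le_iff_le_add (Or.inl (EReal.coe_ne_bot _))
        (Or.inl (EReal.coe_ne_top _)), ← EReal.coe_add] at h1
      refine h1.trans (le_of_eq ?_)
      congr 1; ring
    · rw [EReal.coe_le_coe_iff, hgI, integral_add (hφint lam hlam) (hfi'.const_mul lam),
        integral_const_mul]
      have := mul_le_mul_of_nonneg_left hfc hlam.le
      linarith
  · intro b hb
    set fn : ℕ → Ω → ℝ := fun n ω => if eta ω = 0 then (n : ℝ) else -(DPhi (lam * eta ω)) with hfn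
    set gn : ℕ → Ω → ℝ := fun n ω => if eta ω = 0 then U n else g ω with hgn
    have han : ∀ n : ℕ, a < ((n : ℝ) : EReal) := fun n =>
      ha0.trans_le (EReal.coe_le_coe_iff.2 n.cast_nonneg)
    have hgmeas : Measurable g := (hφmeas lam hlam).add (hF'meas.neg.const_mul lam)
    have hgnmeas : ∀ n, Measurable (gn n) := fun n =>
      Measurable.ite hz_meas measurable_const hgmeas
    have hU0 : ∀ n : ℕ, U 0 ≤ U n := fun n => by
      have := hu_mono (show (0 : ℝ) ≤ n from n.cast_nonneg)
      rwa [coeU 0 ha0, coeU n (han n), EReal.coe_le_coe_iff] at this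
    have hbd : ∀ n, ∀ᵐ ω ∂P, ‖gn n ω‖ ≤ |g ω| + |U 0| := by
      intro n
      filter_upwards [hgae] with ω hω
      by_cases h : eta ω = 0
      · simp only [hgn, h, if_true] at hω ⊢
        have h1 := u_le_sup n
        rw [← hω, coeU n (han n), EReal.coe_le_coe_iff] at h1
        rw [Real.norm_eq_abs, abs_le]
        constructor
        · linarith [hU0 n, neg_abs_le (U 0), abs_nonneg (g ω)]
        · linarith [le_abs_self (g ω), abs_nonneg (U 0)]
      · simp only [hgn, h, if_false, Real.norm_eq_abs]
        linarith [abs_nonneg (U 0)]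
    have hbint : Integrable (fun ω => |g ω| + |U 0|) P := hgint.abs.add (integrable_const _)
    have hgnint : ∀ n, Integrable (gn n) P := fun n =>
      hbint.mono' (hgnmeas n).aestronglyMeasurable (hbd n)
    have hufn : ∀ n, ∀ᵐ ω ∂P, u (fn n ω) = (gn n ω : EReal) := by
      intro n
      filter_upwards [hgae] with ω hω
      by_cases h : eta ω = 0
      · simp only [hfn, hgn, h, if_true]; exact coeU n (han n)
      · simp only [hfn, hgn, h, if_false] at hω ⊢; exact hω.symm
    have hle : ∀ n, ((∫ ω, gn n ω ∂P : ℝ) : EReal) ≤ b := by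
      intro n
      apply hb
      have heq : ∀ ω, eta ω * fn n ω = -(F' lam ω) := by
        intro ω
        by_cases h : eta ω = 0 <;> simp [hfn, hF', h]
      refine ⟨fn n, hDmeas lam hlam n, ?_, ?_, Or.inl ?_, ?_⟩
      · have : (fun ω => eta ω * |fn n ω|) = fun ω => |(-(F' lam ω))| := by
          ext ω
          rw [← heq, abs_mul, abs_of_nonneg (heta_nonneg ω)]
        rw [this]
        exact hnF.abs
      · simp only [heq]; exact hIc.le
      · rw [lintegral_congr_ae (g := fun ω => ENNReal.ofReal (gn n ω))]
        · exact (hgnint n).lintegral_lt_top.ne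
        · filter_upwards [hufn n] with ω hω
          rw [hω, toENN_coe']
      · exact (ewp_eq_integral' P _ _ (hgnint n) (hufn n)).symm
    have htend : Tendsto (fun n => ∫ ω, gn n ω ∂P) atTop (𝓝 (∫ ω, g ω ∂P)) := by
      refine tendsto_integral_of_dominated_convergence _
        (fun n => (hgnmeas n).aestronglyMeasurable) hbint hbd ?_
      filter_upwards [hgae] with ω hω
      by_cases h : eta ω = 0
      · simp only [hgn, h, if_true] at hω ⊢
        have h1 : Tendsto u atTop (𝓝 uSup) := by
          rw [huSup]; exact tendsto_atTop_iSup hu_mono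
        have h2 : Tendsto (fun n : ℕ => u n) atTop (𝓝 uSup) :=
          h1.comp tendsto_natCast_atTop_atTop
        rw [← hω] at h2
        have h3 := (EReal.tendsto_toReal (EReal.coe_ne_top (g ω)) (EReal.coe_ne_bot (g ω))).comp h2
        rw [EReal.toReal_coe] at h3
        exact h3
      · simp only [hgn, h, if_false]; exact tendsto_const_nhds
    exact le_of_tendsto ((continuous_coe_real_ereal.tendsto _).comp htend)
      (Eventually.of_forall hle)
  · by_cases ht : uSup = ⊤
    · rw [ht]; exact EReal.coe_lt_top _
    have hs := φ0 ht
    rw [hs, EReal.coe_lt_coe_iff]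
    have hlt' : ∀ᵐ ω ∂P, g ω ≤ φ 0 ∧ (eta ω ≠ 0 → g ω < φ 0) := by
      filter_upwards [hgae] with ω hω
      by_cases h : eta ω = 0
      · simp only [h, if_true] at hω
        rw [hs, EReal.coe_eq_coe_iff] at hω
        exact ⟨hω.le, fun h' => absurd h h'⟩
      · simp only [h, if_false] at hω
        have h1 := hlt _ (mul_pos hlam (hpos ω h))
        rw [← hω, hs, EReal.coe_lt_coe_iff] at h1
        exact ⟨h1.le, fun _ => h1⟩
    have hle : ∫ ω, g ω ∂P ≤ φ 0 := by
      have := integral_mono_ae hgint (integrable_const (φ 0)) (hlt'.mono fun ω h => h.1)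
      simpa using this
    refine lt_of_le_of_ne hle fun heq => ?_
    have hnn : 0 ≤ᵐ[P] fun ω => φ 0 - g ω := hlt'.mono fun ω h => sub_nonneg.2 h.1
    have hI0 : ∫ ω, (φ 0 - g ω) ∂P = 0 := by
      rw [integral_sub (integrable_const _) hgint, heq]; simp
    rw [integral_eq_zero_iff_of_nonneg_ae hnn ((integrable_const _).sub hgint)] at hI0
    have : ∀ᵐ ω ∂P, ENNReal.ofReal (eta ω) = 0 := by
      filter_upwards [hlt', hI0] with ω h1 h2
      by_cases h : eta ω = 0
      · simp [h]
      · have := h1.2 h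
        simp only [Pi.zero_apply] at h2
        linarith
    rw [lintegral_congr_ae this] at hmean_pos
    simp at hmean_pos

end
end

section
/- Assume (A1) and (A2). Let η ∈ L⁰(P) with η ≥ 0, E[Φ(η)] < ∞ and E[η] > 0. Then the function F(λ) := E[η·Φ'(λη)] (with the convention 0·Φ'(0) := 0 on {η = 0}) is well defined and finite for every λ > 0, and F is a continuous, strictly increasing bijection from (0, ∞) onto (-∞, -a·E[η]) (onto all of ℝ when a = -∞). -/
open MeasureTheory Filter Set Topology
open scoped ENNReal

noncomputable section

/-- Deterministic facts on the conjugate. -/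
lemma conj_facts
    (a : EReal) (ha : a < 0)
    (u : ℝ → EReal)
    (hu_ne_top : ∀ x : ℝ, u x ≠ ⊤)
    (hu_bot : ∀ x : ℝ, (x : EReal) < a → u x = ⊥)
    (hu_fin : ∀ x : ℝ, a < (x : EReal) → u x ≠ ⊥)
    (hu_mono : Monotone u)
    (du : ℝ → ℝ)
    (hdu : ∀ x : ℝ, a < (x : EReal) → HasDerivAt (fun t : ℝ => (u t).toReal) (du x) x)
    (hdu_cont : ContinuousOn du {x : ℝ | a < (x : EReal)})
    (hdu_anti : StrictAntiOn du {x : ℝ | a < (x : EReal)})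
    (hdu_inada_top : ∀ M : ℝ, ∃ x : ℝ, a < (x : EReal) ∧ M ≤ du x)
    (hdu_inada_zero : Tendsto du atTop (𝓝 0))
    (Phi : ℝ → EReal)
    (hPhi : ∀ y : ℝ, Phi y = ⨆ x : ℝ, (u x - ((x * y : ℝ) : EReal)))
    (DPhi : ℝ → ℝ)
    (hDPhi : ∀ y : ℝ, 0 < y → HasDerivAt (fun t : ℝ => (Phi t).toReal) (DPhi y) y) :
    (∀ y, 0 < y → Phi y ≠ ⊤) ∧
    (∀ y, 0 < y → ∀ z : ℝ, a < (z : EReal) → (u z).toReal - z * y ≤ (Phi y).toReal) ∧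
    (∀ y, 0 < y → a < ((-DPhi y : ℝ) : EReal) ∧ du (-DPhi y) = y ∧
      (Phi y).toReal = (u (-DPhi y)).toReal + DPhi y * y) := by
  have hup : ∀ x z : ℝ, a < (x : EReal) → x ≤ z → a < (z : EReal) := fun x z hx hz =>
    lt_of_lt_of_le hx (by exact_mod_cast hz)
  have hcoe : ∀ x : ℝ, a < (x : EReal) → u x = (((u x).toReal : ℝ) : EReal) := fun x hx =>
    (EReal.coe_toReal (hu_ne_top x) (hu_fin x hx)).symm
  -- tangent inequality
  have htan : ∀ x z : ℝ, a < (x : EReal) → a < (z : EReal) →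
      (u z).toReal ≤ (u x).toReal + du x * (z - x) := by
    intro x z hx hz
    rcases lt_trichotomy z x with h | h | h
    · obtain ⟨c, hc, hc'⟩ := exists_hasDerivAt_eq_slope (fun t : ℝ => (u t).toReal) du h
        (fun t ht => (hdu t (hup z t hz ht.1)).continuousAt.continuousWithinAt)
        (fun t ht => hdu t (hup z t hz ht.1.le))
      have h1 := hdu_anti (a := c) (b := x) (hup z c hz hc.1.le) hx hc.2
      rw [hc', lt_div_iff₀ (by linarith)] at h1
      linarith
    · subst h; simp
    · obtain ⟨c, hc, hc'⟩ := exists_hasDerivAt_eq_slope (fun t : ℝ => (u t).toReal) du h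
        (fun t ht => (hdu t (hup x t hx ht.1)).continuousAt.continuousWithinAt)
        (fun t ht => hdu t (hup x t hx ht.1.le))
      have h1 := hdu_anti (a := x) (b := c) hx (hup x c hx hc.1.le) hc.1
      rw [hc', div_lt_iff₀ (by linarith)] at h1
      linarith
  have hlow : ∀ y : ℝ, ∀ z : ℝ, a < (z : EReal) →
      (((u z).toReal - z * y : ℝ) : EReal) ≤ Phi y := by
    intro y z hz
    rw [hPhi y]
    refine le_trans (le_of_eq ?_) (le_iSup _ z)
    conv_rhs => rw [hcoe z hz]
    rw [← EReal.coe_sub]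
  have hval : ∀ x : ℝ, a < (x : EReal) →
      Phi (du x) = (((u x).toReal - x * du x : ℝ) : EReal) := by
    intro x hx
    apply le_antisymm _ (hlow _ x hx)
    rw [hPhi]
    apply iSup_le
    intro z
    rcases lt_trichotomy (z : EReal) a with h | h | h
    · rw [hu_bot z h]; simp
    · -- endpoint
      by_cases hb : u z = ⊥
      · rw [hb]; simp
      have hz : u z = (((u z).toReal : ℝ) : EReal) := (EReal.coe_toReal (hu_ne_top z) hb).symm
      have hzx : ∀ w : ℝ, z < w → (u z).toReal ≤ (u x).toReal + du x * (w - x) := by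
        intro w hw
        have haw : a < (w : EReal) := by rw [← h]; exact_mod_cast hw
        refine le_trans ?_ (htan x w hx haw)
        exact EReal.toReal_le_toReal (hu_mono hw.le) hb (hu_ne_top w)
      have : (u z).toReal ≤ (u x).toReal + du x * (z - x) := by
        have hc : Tendsto (fun w : ℝ => (u x).toReal + du x * (w - x)) (𝓝[>] z)
            (𝓝 ((u x).toReal + du x * (z - x))) := by
          apply tendsto_nhdsWithin_of_tendsto_nhds
          apply Continuous.tendsto
          fun_prop
        exact ge_of_tendsto hc (eventually_mem_nhdsWithin.mono fun w hw => hzx w hw)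
      rw [hz, ← EReal.coe_sub]
      apply EReal.coe_le_coe_iff.2
      nlinarith
    · rw [hcoe z h, ← EReal.coe_sub]
      apply EReal.coe_le_coe_iff.2
      nlinarith [htan x z hx h]
  have hex : ∀ y : ℝ, 0 < y → ∃ x : ℝ, a < (x : EReal) ∧ du x = y := by
    intro y hy
    obtain ⟨x1, hx1, hx1'⟩ := hdu_inada_top y
    obtain ⟨x2, hx2, hx2'⟩ := ((hdu_inada_zero.eventually (gt_mem_nhds hy)).and
      (eventually_ge_atTop x1)).exists
    have := intermediate_value_Icc' hx2' (hdu_cont.mono (fun t ht => hup x1 t hx1 ht.1))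
    obtain ⟨x, hx, hxy⟩ := this ⟨hx2.le, hx1'⟩
    exact ⟨x, hup x1 x hx1 hx.1, hxy⟩
  have h1 : ∀ y, 0 < y → Phi y ≠ ⊤ := by
    intro y hy
    obtain ⟨x, hx, rfl⟩ := hex y hy
    rw [hval x hx]; exact EReal.coe_ne_top _
  have h2 : ∀ y, 0 < y → ∀ z : ℝ, a < (z : EReal) → (u z).toReal - z * y ≤ (Phi y).toReal := by
    intro y hy z hz
    have := EReal.toReal_le_toReal (hlow y z hz) (EReal.coe_ne_bot _) (h1 y hy)
    rwa [EReal.toReal_coe] at this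
  refine ⟨h1, h2, ?_⟩
  intro y hy
  obtain ⟨x, hx, hxy⟩ := hex y hy
  have hv : (Phi y).toReal = (u x).toReal - x * y := by
    rw [← hxy, hval x hx, EReal.toReal_coe]
  have hmin : IsLocalMin (fun t : ℝ => (Phi t).toReal + x * t) y := by
    filter_upwards [lt_mem_nhds hy] with t ht
    have := h2 t ht x hx
    rw [hv]; linarith
  have hd : HasDerivAt (fun t : ℝ => (Phi t).toReal + x * t) (DPhi y + x * 1) y :=
    (hDPhi y hy).add ((hasDerivAt_id y).const_mul x)
  have h0 := hmin.hasDerivAt_eq_zero hd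
  have hx' : -DPhi y = x := by linarith
  rw [hx']
  refine ⟨hx, hxy, ?_⟩
  rw [hv]
  have : DPhi y = -x := by linarith
  rw [this]; ring

/-- Probabilistic part, for an abstract derivative `D`. -/
lemma prob_part {Ω : Type*} [MeasurableSpace Ω] (P : Measure Ω)
    (a : EReal) (ha : a < 0) (D : ℝ → ℝ) (hDm : StrictMonoOn D (Ioi 0))
    (hDc : ContinuousOn D (Ioi 0))
    (hDlow : ∀ C : ℝ, ∃ y, 0 < y ∧ D y ≤ -C)
    (hDlt : ∀ y, 0 < y → a < ((-D y : ℝ) : EReal))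
    (hDup : ∀ b : ℝ, a < (b : EReal) → ∃ y, 0 < y ∧ -b ≤ D y)
    (eta : Ω → ℝ) (heta_nonneg : ∀ ω, 0 ≤ eta ω)
    (heta_int : Integrable eta P)
    (hmean_pos : 0 < ∫⁻ ω, ENNReal.ofReal (eta ω) ∂P)
    (f : ℝ → Ω → ℝ)
    (hf0 : ∀ t ω, eta ω = 0 → f t ω = 0)
    (hf1 : ∀ t ω, 0 < eta ω → f t ω = eta ω * D (t * eta ω))
    (hfi : ∀ t, 0 < t → Integrable (f t) P)
    (F : ℝ → ℝ) (hF : ∀ t, F t = ∫ ω, f t ω ∂P) :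
    ContinuousOn F (Ioi (0 : ℝ)) ∧
    StrictMonoOn F (Ioi (0 : ℝ)) ∧
    (∀ t : ℝ, 0 < t →
      ((F t : ℝ) : EReal) < (-a) * ((∫⁻ ω, ENNReal.ofReal (eta ω) ∂P : ℝ≥0∞) : EReal)) ∧
    (∀ r : ℝ, ((r : ℝ) : EReal) < (-a) * ((∫⁻ ω, ENNReal.ofReal (eta ω) ∂P : ℝ≥0∞) : EReal) →
      ∃ t : ℝ, 0 < t ∧ F t = r) := by
  set M : ℝ := ∫ ω, eta ω ∂P with hM
  have hm : ∫⁻ ω, ENNReal.ofReal (eta ω) ∂P = ENNReal.ofReal M :=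
    (ofReal_integral_eq_lintegral_ofReal heta_int (Eventually.of_forall heta_nonneg)).symm
  rw [hm] at hmean_pos ⊢
  have hMpos : 0 < M := ENNReal.ofReal_pos.1 hmean_pos
  have hMe : ((ENNReal.ofReal M : ℝ≥0∞) : EReal) = (M : EReal) := by
    rw [EReal.coe_ennreal_ofReal, max_eq_left hMpos.le]
  rw [hMe]
  have hsupp : 0 < P (Function.support eta) :=
    (integral_pos_iff_support_of_nonneg heta_nonneg heta_int).1 hMpos
  -- strict integral comparison
  have hstrict : ∀ g h : Ω → ℝ, Integrable g P → Integrable h P →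
      (∀ ω, eta ω = 0 → g ω = h ω) → (∀ ω, 0 < eta ω → g ω < h ω) →
      ∫ ω, g ω ∂P < ∫ ω, h ω ∂P := by
    intro g h hg hh h0 h1
    have hsub : 0 < ∫ ω, (h ω - g ω) ∂P := by
      refine (integral_pos_iff_support_of_nonneg (f := fun ω => h ω - g ω) ?_ (hh.sub hg)).2 ?_
      rotate_left
      · refine lt_of_lt_of_le hsupp (measure_mono ?_)
        intro ω hω
        have := h1 ω (lt_of_le_of_ne (heta_nonneg ω) (Ne.symm hω))
        exact (sub_pos.2 this).ne'
      · intro ω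
        rcases (heta_nonneg ω).eq_or_lt with h | h
        · simp [h0 ω h.symm]
        · exact (sub_pos.2 (h1 ω h)).le
    rw [integral_sub hh hg] at hsub
    linarith
  have hfmono : ∀ s t ω, 0 < s → s ≤ t → f s ω ≤ f t ω := by
    intro s t ω hs hst
    rcases (heta_nonneg ω).eq_or_lt with h | h
    · rw [hf0 s ω h.symm, hf0 t ω h.symm]
    · rw [hf1 s ω h, hf1 t ω h]
      apply mul_le_mul_of_nonneg_left _ h.le
      exact hDm.monotoneOn (mul_pos hs h : (0:ℝ) < s * eta ω)
        (mul_pos (hs.trans_le hst) h : (0:ℝ) < t * eta ω) (mul_le_mul_of_nonneg_right hst h.le)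
  have hcont : ContinuousOn F (Ioi (0 : ℝ)) := by
    intro t ht
    have ht : 0 < t := ht
    apply ContinuousAt.continuousWithinAt
    have hFe : F = fun t => ∫ ω, f t ω ∂P := funext hF
    rw [hFe]
    have hn : ∀ᶠ s in 𝓝 t, t / 2 < s ∧ s < t + 1 :=
      (lt_mem_nhds (by linarith)).and (gt_mem_nhds (by linarith))
    refine continuousAt_of_dominated (bound := fun ω => |f (t/2) ω| + |f (t+1) ω|) ?_ ?_ ?_ ?_
    · filter_upwards [hn] with s hs
      exact (hfi s (by linarith)).aestronglyMeasurable
    · filter_upwards [hn] with s hs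
      refine Eventually.of_forall fun ω => ?_
      have h1 := hfmono (t/2) s ω (by linarith) hs.1.le
      have h2 := hfmono s (t+1) ω (by linarith) hs.2.le
      rw [Real.norm_eq_abs, abs_le]
      constructor
      · linarith [neg_abs_le (f (t/2) ω), abs_nonneg (f (t+1) ω)]
      · linarith [le_abs_self (f (t+1) ω), abs_nonneg (f (t/2) ω)]
    · exact (hfi _ (by linarith)).abs.add (hfi _ (by linarith)).abs
    · refine Eventually.of_forall fun ω => ?_
      rcases (heta_nonneg ω).eq_or_lt with h | h
      · have : (fun x => f x ω) = fun _ => 0 := funext fun x => hf0 x ω h.symm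
        rw [this]; exact continuousAt_const
      · have : (fun x => f x ω) = fun x => eta ω * D (x * eta ω) := funext fun x => hf1 x ω h
        rw [this]
        apply ContinuousAt.mul continuousAt_const
        have hD : ContinuousAt D (t * eta ω) := hDc.continuousAt (Ioi_mem_nhds (mul_pos ht h))
        exact ContinuousAt.comp (f := fun x => x * eta ω) hD (by fun_prop)
  -- below any level
  have hlow : ∀ r : ℝ, ∃ t, 0 < t ∧ F t ≤ r := by
    intro r
    obtain ⟨C, hC⟩ : ∃ C : ℝ, -C * M < r := ⟨(|r| + 1) / M, by
      rw [neg_mul, div_mul_cancel₀ _ hMpos.ne']; linarith [neg_abs_le r]⟩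
    have ht : Tendsto (fun t : ℝ => ∫ ω, max (f t ω) (-C * eta ω) ∂P) (𝓝[>] 0)
        (𝓝 (∫ ω, -C * eta ω ∂P)) := by
      have hn : ∀ᶠ s : ℝ in 𝓝[>] 0, 0 < s ∧ s < 1 :=
        eventually_mem_nhdsWithin.and (mem_nhdsWithin_of_mem_nhds (gt_mem_nhds one_pos))
      refine tendsto_integral_filter_of_dominated_convergence
        (fun ω => |f 1 ω| + |-C * eta ω|) ?_ ?_ ?_ ?_
      · filter_upwards [hn] with s hs
        exact ((hfi s hs.1).sup (heta_int.const_mul (-C))).aestronglyMeasurable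
      · filter_upwards [hn] with s hs
        refine Eventually.of_forall fun ω => ?_
        have h1 := hfmono s 1 ω hs.1 hs.2.le
        rw [Real.norm_eq_abs, abs_le]
        constructor
        · linarith [neg_abs_le (-C * eta ω), abs_nonneg (f 1 ω), le_max_right (f s ω) (-C * eta ω)]
        · apply max_le
          · linarith [le_abs_self (f 1 ω), abs_nonneg (-C * eta ω)]
          · linarith [le_abs_self (-C * eta ω), abs_nonneg (f 1 ω)]
      · exact (hfi 1 one_pos).abs.add (heta_int.const_mul (-C)).abs
      · refine Eventually.of_forall fun ω => ?_
        apply tendsto_const_nhds.congr'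
        rcases (heta_nonneg ω).eq_or_lt with h | h
        · refine Eventually.of_forall fun t => ?_
          simp [hf0 t ω h.symm, ← h]
        · obtain ⟨y, hy, hy'⟩ := hDlow C
          have hev : ∀ᶠ s : ℝ in 𝓝[>] 0, s < y / eta ω :=
            mem_nhdsWithin_of_mem_nhds (gt_mem_nhds (div_pos hy h))
          filter_upwards [hn, hev] with s hs hs'
          rw [max_eq_right]
          rw [hf1 s ω h, mul_comm (-C)]
          apply mul_le_mul_of_nonneg_left _ h.le
          rw [lt_div_iff₀ h] at hs'
          exact (hDm.monotoneOn (mul_pos hs.1 h : (0:ℝ) < s * eta ω) hy hs'.le).trans hy'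
    rw [integral_const_mul] at ht
    obtain ⟨t, ht1, ht2⟩ := ((ht.eventually (gt_mem_nhds hC)).and
      (eventually_mem_nhdsWithin : ∀ᶠ s : ℝ in 𝓝[>] 0, s ∈ Ioi 0)).exists
    refine ⟨t, ht2, le_trans ?_ ht1.le⟩
    rw [hF]
    exact integral_mono (hfi t ht2) ((hfi t ht2).sup (heta_int.const_mul (-C)))
      (fun ω => le_max_left _ _)
  -- above any level
  have hhigh : ∀ r : ℝ, (r : EReal) < -a * (M : EReal) → ∃ t, 0 < t ∧ r ≤ F t := by
    intro r hr
    obtain ⟨C, hCa, hC⟩ : ∃ C : ℝ, a < (C : EReal) ∧ r < -C * M := by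
      induction a with
      | bot =>
        refine ⟨-((|r| + 1) / M), EReal.bot_lt_coe _, ?_⟩
        rw [neg_neg, div_mul_cancel₀ _ hMpos.ne']; linarith [le_abs_self r]
      | coe x =>
        have hr' : r < -x * M := by exact_mod_cast hr
        obtain ⟨q, hq1, hq2⟩ := exists_between ((div_lt_iff₀ hMpos).2 hr')
        refine ⟨-q, ?_, ?_⟩
        · exact_mod_cast (by linarith : x < -q)
        · rw [neg_neg]; exact (div_lt_iff₀ hMpos).1 hq1
      | top => exact absurd ha (by simp)
    have ht : Tendsto (fun t : ℝ => ∫ ω, min (f t ω) (-C * eta ω) ∂P) atTop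
        (𝓝 (∫ ω, -C * eta ω ∂P)) := by
      have hn : ∀ᶠ s : ℝ in atTop, 1 ≤ s := eventually_ge_atTop 1
      refine tendsto_integral_filter_of_dominated_convergence
        (fun ω => |f 1 ω| + |-C * eta ω|) ?_ ?_ ?_ ?_
      · filter_upwards [hn] with s hs
        exact ((hfi s (by linarith)).inf (heta_int.const_mul (-C))).aestronglyMeasurable
      · filter_upwards [hn] with s hs
        refine Eventually.of_forall fun ω => ?_
        have h1 := hfmono 1 s ω one_pos hs
        rw [Real.norm_eq_abs, abs_le]
        constructor
        · apply le_min
          · linarith [neg_abs_le (f 1 ω), abs_nonneg (-C * eta ω)]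
          · linarith [neg_abs_le (-C * eta ω), abs_nonneg (f 1 ω)]
        · linarith [le_abs_self (-C * eta ω), abs_nonneg (f 1 ω), min_le_right (f s ω) (-C * eta ω)]
      · exact (hfi 1 one_pos).abs.add (heta_int.const_mul (-C)).abs
      · refine Eventually.of_forall fun ω => ?_
        apply tendsto_const_nhds.congr'
        rcases (heta_nonneg ω).eq_or_lt with h | h
        · refine Eventually.of_forall fun t => ?_
          simp [hf0 t ω h.symm, ← h]
        · obtain ⟨y, hy, hy'⟩ := hDup C hCa
          filter_upwards [hn, eventually_ge_atTop (y / eta ω)] with s hs hs'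
          rw [min_eq_right]
          rw [hf1 s ω h, mul_comm (-C)]
          apply mul_le_mul_of_nonneg_left _ h.le
          rw [div_le_iff₀ h] at hs'
          exact hy'.trans (hDm.monotoneOn hy (lt_of_lt_of_le hy hs' : (0:ℝ) < s * eta ω) hs')
    rw [integral_const_mul] at ht
    obtain ⟨t, ht1, ht2⟩ := ((ht.eventually (lt_mem_nhds hC)).and
      (eventually_gt_atTop (0:ℝ))).exists
    refine ⟨t, ht2, ht1.le.trans ?_⟩
    rw [hF]
    exact integral_mono ((hfi t ht2).inf (heta_int.const_mul (-C))) (hfi t ht2)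
      (fun ω => min_le_left _ _)
  refine ⟨hcont, ?_, ?_, ?_⟩
  · intro s hs t ht hst
    have hs : 0 < s := hs
    have ht : 0 < t := ht
    rw [hF, hF]
    refine hstrict _ _ (hfi s hs) (hfi t ht) (fun ω h => by rw [hf0 s ω h, hf0 t ω h]) ?_
    intro ω h
    rw [hf1 s ω h, hf1 t ω h]
    apply mul_lt_mul_of_pos_left _ h
    exact hDm (mul_pos hs h : (0:ℝ) < s * eta ω) (mul_pos ht h : (0:ℝ) < t * eta ω)
      (mul_lt_mul_of_pos_right hst h)
  · intro t ht
    induction a with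
    | bot =>
      rw [EReal.neg_bot, EReal.top_mul_coe_of_pos hMpos]
      exact EReal.coe_lt_top _
    | coe x =>
      have : F t < -x * M := by
        rw [hF, hM, ← integral_const_mul]
        refine hstrict _ _ (hfi t ht) (heta_int.const_mul _) (fun ω h => by simp [hf0 t ω h, h]) ?_
        intro ω h
        rw [hf1 t ω h, mul_comm (-x)]
        apply mul_lt_mul_of_pos_left _ h
        have := hDlt (t * eta ω) (mul_pos ht h)
        have := EReal.coe_lt_coe_iff.1 this
        linarith
      exact_mod_cast this
    | top => exact absurd ha (by simp)
  · intro r hr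
    obtain ⟨s, hs, hs'⟩ := hlow r
    obtain ⟨t, ht, ht'⟩ := hhigh r hr
    obtain ⟨x, hx, hx'⟩ := isPreconnected_Ioi.intermediate_value (a := s) (b := t) hs ht hcont
      ⟨hs', ht'⟩
    exact ⟨x, hx, hx'⟩

/-- Assume (A1), (A2) and let `η ≥ 0` with `E[Φ(η)] < ∞` and `E[η] > 0`.
Then `F(λ) := E[η·Φ'(λη)]` (with `0·Φ'(0) := 0` on `{η = 0}`) is well defined and finite for
every `λ > 0`, and `F` is a continuous, strictly increasing bijection from `(0, ∞)` onto
`(-∞, -a·E[η])` (onto all of `ℝ` when `a = -∞`). -/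
theorem statement14
    {Ω : Type*} [MeasurableSpace Ω] (P : Measure Ω) [IsProbabilityMeasure P]
    (a : EReal) (ha : a < 0)
    (u : ℝ → EReal)
    (hu_ne_top : ∀ x : ℝ, u x ≠ ⊤)
    (hu_bot : ∀ x : ℝ, (x : EReal) < a → u x = ⊥)
    (hu_fin : ∀ x : ℝ, a < (x : EReal) → u x ≠ ⊥)
    (hu_mono : Monotone u)
    (hu_lim : Tendsto u atBot (𝓝 ⊥))
    (du : ℝ → ℝ)
    (hdu : ∀ x : ℝ, a < (x : EReal) → HasDerivAt (fun t : ℝ => (u t).toReal) (du x) x)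
    (hdu_cont : ContinuousOn du {x : ℝ | a < (x : EReal)})
    (hdu_pos : ∀ x : ℝ, a < (x : EReal) → 0 < du x)
    (hdu_anti : StrictAntiOn du {x : ℝ | a < (x : EReal)})
    (hdu_inada_top : ∀ M : ℝ, ∃ x : ℝ, a < (x : EReal) ∧ M ≤ du x)
    (hdu_inada_zero : Tendsto du atTop (𝓝 0))
    (Phi : ℝ → EReal)
    (hPhi : ∀ y : ℝ, Phi y = ⨆ x : ℝ, (u x - ((x * y : ℝ) : EReal)))
    (hA2 : ∀ g : Ω → ℝ, Measurable g → (∀ ω, 0 ≤ g ω) →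
      ∫⁻ ω, (Phi (g ω)).toENN ∂P < ⊤ →
      ∀ l : ℝ, 0 < l → ∫⁻ ω, (Phi (l * g ω)).toENN ∂P < ⊤)
    (DPhi : ℝ → ℝ)
    (hDPhi : ∀ y : ℝ, 0 < y → HasDerivAt (fun t : ℝ => (Phi t).toReal) (DPhi y) y)
    -- `η ∈ L_Φ` with `E[η] > 0`
    (eta : Ω → ℝ) (heta_meas : Measurable eta) (heta_nonneg : ∀ ω, 0 ≤ eta ω)
    (hetaPhi : ∫⁻ ω, (Phi (eta ω)).toENN ∂P < ⊤)
    (hmean_pos : 0 < ∫⁻ ω, ENNReal.ofReal (eta ω) ∂P)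
    -- `F(λ) = E[η·Φ'(λη)]`
    (F : ℝ → ℝ)
    (hF : ∀ t : ℝ, F t = ∫ ω, (if eta ω = 0 then 0 else eta ω * DPhi (t * eta ω)) ∂P) :
    -- `F` is well defined (and finite) on `(0, ∞)` …
    (∀ t : ℝ, 0 < t →
      Integrable (fun ω => if eta ω = 0 then 0 else eta ω * DPhi (t * eta ω)) P) ∧
    -- … continuous and strictly increasing on `(0, ∞)` …
    ContinuousOn F (Ioi (0 : ℝ)) ∧
    StrictMonoOn F (Ioi (0 : ℝ)) ∧
    -- … with range exactly `(-∞, -a·E[η])`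
    (∀ t : ℝ, 0 < t →
      ((F t : ℝ) : EReal) < (-a) * ((∫⁻ ω, ENNReal.ofReal (eta ω) ∂P : ℝ≥0∞) : EReal)) ∧
    (∀ r : ℝ, ((r : ℝ) : EReal) < (-a) * ((∫⁻ ω, ENNReal.ofReal (eta ω) ∂P : ℝ≥0∞) : EReal) →
      ∃ t : ℝ, 0 < t ∧ F t = r) := by
  obtain ⟨h1, h2, h3⟩ := conj_facts a ha u hu_ne_top hu_bot hu_fin hu_mono du hdu hdu_cont hdu_anti
    hdu_inada_top hdu_inada_zero Phi hPhi DPhi hDPhi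
  have hDm : StrictMonoOn DPhi (Ioi 0) := by
    intro y hy z hz hyz
    obtain ⟨hy1, hy2, -⟩ := h3 y hy
    obtain ⟨hz1, hz2, -⟩ := h3 z hz
    have : du (-DPhi y) < du (-DPhi z) := by rw [hy2, hz2]; exact hyz
    have := (hdu_anti.lt_iff_gt hy1 hz1).1 this
    linarith
  have hsurj : ∀ x : ℝ, a < (x : EReal) → DPhi (du x) = -x := by
    intro x hx
    obtain ⟨hy1, hy2, -⟩ := h3 (du x) (hdu_pos x hx)
    have := hdu_anti.injOn hy1 hx hy2
    linarith
  have hDc : ContinuousOn DPhi (Ioi 0) := by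
    intro y hy
    apply ContinuousAt.continuousWithinAt
    apply hDm.continuousAt_of_image_mem_nhds (Ioi_mem_nhds hy)
    have hopen : IsOpen {z : ℝ | a < ((-z : ℝ) : EReal)} :=
      isOpen_lt continuous_const (continuous_coe_real_ereal.comp continuous_neg)
    refine mem_of_superset (hopen.mem_nhds (h3 y hy).1) ?_
    intro z hz
    refine ⟨du (-z), hdu_pos _ hz, ?_⟩
    rw [hsurj _ hz, neg_neg]
  set phi : ℝ → ℝ := fun t => (Phi t).toReal with hphi
  have htan : ∀ y z, 0 < y → 0 < z → phi y + DPhi y * (z - y) ≤ phi z := by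
    intro y z hy hz
    obtain ⟨hy1, hy2, hy3⟩ := h3 y hy
    have := h2 z hz _ hy1
    simp only [hphi]
    rw [hy3]; linarith
  have ha0 : a < ((0 : ℝ) : EReal) := by simpa using ha
  have hphic : ContinuousOn phi (Ioi 0) := fun y hy =>
    (hDPhi y hy).continuousAt.continuousWithinAt
  classical
  have hphim : Measurable ((Ioi (0:ℝ)).piecewise phi (fun _ => 0)) :=
    hphic.measurable_piecewise continuousOn_const measurableSet_Ioi
  have hDmeas : Measurable ((Ioi (0:ℝ)).piecewise DPhi (fun _ => 0)) :=
    hDc.measurable_piecewise continuousOn_const measurableSet_Ioi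
  set g : ℝ → Ω → ℝ := fun l ω => (Ioi (0:ℝ)).piecewise phi (fun _ => 0) (l * eta ω) with hg
  have hg0 : ∀ l ω, eta ω = 0 → g l ω = 0 := by
    intro l ω h; simp [hg, h]
  have hg1 : ∀ l ω, 0 < l → 0 < eta ω → g l ω = phi (l * eta ω) := by
    intro l ω hl h
    exact piecewise_eq_of_mem _ _ _ (mul_pos hl h : (0:ℝ) < l * eta ω)
  have hgi : ∀ l, 0 < l → Integrable (g l) P := by
    intro l hl
    refine ⟨(hphim.comp (heta_meas.const_mul l)).aestronglyMeasurable, ?_⟩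
    have hfin := hA2 eta heta_meas heta_nonneg hetaPhi l hl
    rw [hasFiniteIntegral_iff_norm]
    set c : ℝ := |(u 0).toReal| with hc
    refine lt_of_le_of_lt (b := ∫⁻ ω, ((Phi (l * eta ω)).toENN + ENNReal.ofReal c) ∂P)
      (lintegral_mono fun ω => ?_) ?_
    · rcases (heta_nonneg ω).eq_or_lt with h | h
      · simp [hg0 l ω h.symm]
      · have hpos := mul_pos hl h
        rw [hg1 l ω hl h, EReal.toENN, if_neg (h1 _ hpos)]
        have hb := h2 _ hpos 0 ha0
        rw [zero_mul, sub_zero] at hb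
        rw [Real.norm_eq_abs]
        rcases le_total 0 (phi (l * eta ω)) with hp | hp
        · rw [abs_of_nonneg hp]; exact le_self_add
        · refine le_trans (ENNReal.ofReal_le_ofReal ?_) le_add_self
          rw [abs_of_nonpos hp]
          have hb' : (u 0).toReal ≤ phi (l * eta ω) := hb
          linarith [neg_abs_le (u 0).toReal]
    · rw [lintegral_add_right _ measurable_const]
      simp [hfin]
  -- `eta` is integrable
  have heta_int : Integrable eta P := by
    obtain ⟨x, hx1, hx2⟩ := EReal.lt_iff_exists_real_btwn.1 ha
    have hx2 : x < 0 := by exact_mod_cast hx2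
    refine Integrable.mono' (g := fun ω => (-x)⁻¹ * (|g 1 ω| + |(u x).toReal|))
      (((hgi 1 one_pos).abs.add (integrable_const _)).const_mul _)
      heta_meas.aestronglyMeasurable (Eventually.of_forall fun ω => ?_)
    have hx3 : 0 < -x := by linarith
    rw [Real.norm_eq_abs, abs_of_nonneg (heta_nonneg ω), inv_mul_eq_div, le_div_iff₀ hx3]
    rcases (heta_nonneg ω).eq_or_lt with h | h
    · rw [← h, zero_mul]; positivity
    · have hb : (u x).toReal - x * eta ω ≤ phi (eta ω) := h2 _ h x hx1
      rw [hg1 1 ω one_pos h, one_mul]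
      linarith [le_abs_self (phi (eta ω)), neg_abs_le (u x).toReal]
  set f : ℝ → Ω → ℝ := fun t ω => if eta ω = 0 then 0 else eta ω * DPhi (t * eta ω) with hfdef
  have hf0 : ∀ t ω, eta ω = 0 → f t ω = 0 := fun t ω h => if_pos h
  have hf1 : ∀ t ω, 0 < eta ω → f t ω = eta ω * DPhi (t * eta ω) := fun t ω h => if_neg h.ne'
  have hfi : ∀ t, 0 < t → Integrable (f t) P := by
    intro t ht
    have hfe : f t = fun ω => eta ω * (Ioi (0:ℝ)).piecewise DPhi (fun _ => 0) (t * eta ω) := by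
      funext ω
      rcases (heta_nonneg ω).eq_or_lt with h | h
      · rw [hf0 t ω h.symm, ← h, zero_mul]
      · rw [hf1 t ω h, piecewise_eq_of_mem (Ioi (0:ℝ)) _ _ (mem_Ioi.2 (mul_pos ht h))]
    have hfm : Measurable (f t) := by
      rw [hfe]
      exact heta_meas.mul (hDmeas.comp (heta_meas.const_mul t))
    have ht2 : 0 < t / 2 := by linarith
    have ht1 : 0 < t + 1 := by linarith
    refine Integrable.mono'
      (g := fun ω => (|g (t+1) ω| + |g t ω|) + (t/2)⁻¹ * (|g t ω| + |g (t/2) ω|))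
      (((hgi _ ht1).abs.add (hgi _ ht).abs).add
        (((hgi _ ht).abs.add (hgi _ ht2).abs).const_mul _))
      hfm.aestronglyMeasurable (Eventually.of_forall fun ω => ?_)
    rcases (heta_nonneg ω).eq_or_lt with h | h
    · rw [hf0 t ω h.symm, norm_zero]; positivity
    · rw [hf1 t ω h, hg1 _ ω ht1 h, hg1 _ ω ht h, hg1 _ ω ht2 h, Real.norm_eq_abs]
      have hA := htan _ _ (mul_pos ht h) (mul_pos ht1 h)
      have hB := htan _ _ (mul_pos ht h) (mul_pos ht2 h)
      set p := phi (t * eta ω)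
      set q := phi ((t+1) * eta ω)
      set r := phi (t / 2 * eta ω)
      set d := DPhi (t * eta ω)
      have hA' : eta ω * d ≤ q - p := by nlinarith
      have hB' : -(eta ω * d) ≤ (t/2)⁻¹ * (|p| + |r|) := by
        rw [inv_mul_eq_div, le_div_iff₀ ht2]
        nlinarith [neg_abs_le p, le_abs_self r]
      have h5 : 0 ≤ (t/2)⁻¹ * (|p| + |r|) := by positivity
      rw [abs_le]
      constructor
      · linarith [abs_nonneg p, abs_nonneg q]
      · linarith [le_abs_self q, neg_abs_le p]
  refine ⟨hfi, prob_part P a ha DPhi hDm hDc ?_ (fun y hy => (h3 y hy).1) ?_ eta heta_nonneg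
    heta_int hmean_pos f hf0 hf1 hfi F hF⟩
  · intro C
    have hx : a < ((max C 0 : ℝ) : EReal) :=
      lt_of_lt_of_le ha0 (by exact_mod_cast le_max_right C 0)
    refine ⟨du (max C 0), hdu_pos _ hx, ?_⟩
    rw [hsurj _ hx]
    linarith [le_max_left C 0]
  · intro b hb
    exact ⟨du b, hdu_pos b hb, (hsurj b hb).ge⟩


end
end
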